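/- Let α : ℝ → ℝ be continuous and positive, L > 0, and let ψ be concave and positive on (0,L/2). Then for any (z,t) ∈ (0,L/2) × (0,∞) and any ρ < ψ₊(z,t), there exists an L-periodic regular solution u of ∂_t u = α(∂_x u) ∂²_x u on ℝ × [0,∞) such that ψ is a modulus of continuity for u(·,0), yet there exists x ∈ ℝ with |u(x+2z,t) − u(x,t)| > 2ρ. -/

import Mathlib

open Set Real Filter

/-- Partial derivative in the spatial variable. -/
noncomputable def pderivX (u : ℝ → ℝ → ℝ) (x t : ℝ) : ℝ := deriv (fun y => u y t) x

/-- Second partial derivative in the spatial variable. -/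
noncomputable def pderivXX (u : ℝ → ℝ → ℝ) (x t : ℝ) : ℝ := deriv (fun y => pderivX u y t) x

/-- Partial derivative in the time variable. -/
noncomputable def pderivT (u : ℝ → ℝ → ℝ) (x t : ℝ) : ℝ := deriv (fun s => u x s) t

/-- `u` is regular on `S`: it is continuous, has spatial derivatives up to second order and a
first time derivative on `S`, and these are continuous on `S`. -/
def RegularOn (u : ℝ → ℝ → ℝ) (S : Set (ℝ × ℝ)) : Prop :=
  ContinuousOn (fun p : ℝ × ℝ => u p.1 p.2) S ∧
  (∀ p ∈ S, DifferentiableAt ℝ (fun y => u y p.2) p.1) ∧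
  (∀ p ∈ S, DifferentiableAt ℝ (fun y => pderivX u y p.2) p.1) ∧
  (∀ p ∈ S, DifferentiableAt ℝ (fun s => u p.1 s) p.2) ∧
  ContinuousOn (fun p : ℝ × ℝ => pderivX u p.1 p.2) S ∧
  ContinuousOn (fun p : ℝ × ℝ => pderivXX u p.1 p.2) S ∧
  ContinuousOn (fun p : ℝ × ℝ => pderivT u p.1 p.2) S

/-- `ψ` is a modulus of continuity for the `L`-periodic function `u`. -/
def IsModulus (L : ℝ) (ψ : ℝ → ℝ) (u : ℝ → ℝ) : Prop :=
  ∀ x y : ℝ, 0 < y - x → y - x < L →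
    -(2 * ψ ((L + x - y) / 2)) ≤ u y - u x ∧ u y - u x ≤ 2 * ψ ((y - x) / 2)

/-- Membership in the class `S_ψ` of supersolutions of `∂ₜφ = α(φ')φ''` on
`[0, L/2] × [0, ∞)` lying above `ψ` at time `0`. -/
def MemS (α : ℝ → ℝ) (L : ℝ) (ψ : ℝ → ℝ) (φ : ℝ → ℝ → ℝ) : Prop :=
  (∀ z t : ℝ, z ∈ Icc 0 (L/2) → 0 ≤ t → 0 ≤ φ z t) ∧
  ContinuousOn (fun p : ℝ × ℝ => φ p.1 p.2)
    ((Icc 0 (L/2) ×ˢ Ici 0) \ {((0:ℝ), (0:ℝ)), ((L/2 : ℝ), (0:ℝ))}) ∧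
  RegularOn φ (Ioo 0 (L/2) ×ˢ Ioi 0) ∧
  (∀ z t : ℝ, z ∈ Ioo 0 (L/2) → 0 < t →
    α (pderivX φ z t) * pderivXX φ z t ≤ pderivT φ z t) ∧
  (∀ z ∈ Ioo (0:ℝ) (L/2), ψ z ≤ φ z 0)

/-- The minimal supersolution `ψ₊`. -/
noncomputable def psiPlus (α : ℝ → ℝ) (L : ℝ) (ψ : ℝ → ℝ) (z t : ℝ) : ℝ :=
  sInf {y : ℝ | ∃ φ : ℝ → ℝ → ℝ, MemS α L ψ φ ∧ φ z t = y}

open scoped Topology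

lemma int_increment_le {g : ℤ → ℝ} {a b : ℤ} {C : ℝ} (hab : a ≤ b)
    (hg : ∀ l, a ≤ l → l < b → g (l + 1) - g l ≤ C) : g b - g a ≤ C * (b - a) := by
  induction b, hab using Int.leInduction with
  | base => simp
  | succ m hm ih =>
    have h1 := ih fun l hl hl' => hg l hl (by omega)
    have h2 := hg m hm (by omega)
    push_cast
    linarith

lemma int_le_increment {g : ℤ → ℝ} {a b : ℤ} {C : ℝ} (hab : a ≤ b)
    (hg : ∀ l, a ≤ l → l < b → C ≤ g (l + 1) - g l) : C * (b - a) ≤ g b - g a := by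
  have := int_increment_le (g := fun l => -g l) (C := -C) hab
    fun l hl hl' => by have := hg l hl hl'; linarith
  linarith

lemma barrier_step {m ℓ x y p c₁ c₂ : ℝ} (hℓ : 0 < ℓ) (hm : 2 ≤ ℓ * m)
    (hm0 : 0 < m) (hp : 0 ≤ p) (hs : m ≤ p + x ^ 2 + y ^ 2) (hℓ4 : ℓ ≤ 1 / 4)
    (h1 : ℓ ≤ c₁) (h1' : c₁ ≤ 1 / 4) (h2 : ℓ ≤ c₂) (h2' : c₂ ≤ 1 / 4)
    {B : ℝ → ℝ} (hB : ∀ q, B q = q + q ^ 2 / (ℓ * m)) :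
    (1 - 8 / (ℓ * m)) * B p ≤ (1 - 2 * c₁ - 2 * c₂) * B (p - 1)
      + c₁ * (B (p - 2 - 2 * x) + B (p - 2 + 2 * x))
      + c₂ * (B (p - 2 - 2 * y) + B (p - 2 + 2 * y)) := by
  simp only [hB]
  have hlm : 0 < ℓ * m := by positivity
  set μ := 1 / (ℓ * m) with hμ
  have hμ0 : 0 < μ := by positivity
  have hμ1 : μ ≤ 1 / 2 := by
    rw [hμ, div_le_div_iff₀ hlm two_pos]; linarith
  have hμm : μ * (ℓ * m) = 1 := by rw [hμ]; field_simp
  have e1 : ∀ z : ℝ, z / (ℓ * m) = μ * z := fun z => by rw [hμ]; ring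
  simp only [e1]
  have key : 2 + 4 * μ * p ≤ 8 * μ * ℓ * (x ^ 2 + y ^ 2) + 8 * μ * (p + μ * p ^ 2) := by
    rcases le_total p (ℓ * m / 2) with h | h
    · have hr : m / 2 ≤ x ^ 2 + y ^ 2 := by nlinarith
      have : 8 * μ * ℓ * (m / 2) ≤ 8 * μ * ℓ * (x ^ 2 + y ^ 2) := by gcongr
      have h3 : μ * p ≤ μ * (ℓ * m / 2) := by gcongr
      have h4 : 0 ≤ 8 * μ * (p + μ * p ^ 2) := by positivity
      nlinarith
    · have h3 : μ * (ℓ * m / 2) ≤ μ * p := by gcongr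
      have h4 : 0 ≤ 8 * μ * ℓ * (x ^ 2 + y ^ 2) := by positivity
      have h5 : 0 ≤ 8 * μ * (μ * p ^ 2) := by positivity
      nlinarith
  have hq : 0 ≤ 1 + 2 * μ * (p - 1) := by nlinarith [mul_nonneg hμ0.le hp]
  have k1 : 8 * μ * ℓ * x ^ 2 ≤ 8 * μ * c₁ * x ^ 2 := by gcongr
  have k2 : 8 * μ * ℓ * y ^ 2 ≤ 8 * μ * c₂ * y ^ 2 := by gcongr
  have k3 : (c₁ + c₂) * (1 + 2 * μ * (p - 1)) ≤ 1 / 2 * (1 + 2 * μ * (p - 1)) := by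
    gcongr; linarith
  have k4 : 0 ≤ μ * (c₁ + c₂) := by
    have : 0 ≤ c₁ + c₂ := by linarith
    positivity
  nlinarith

set_option maxHeartbeats 2000000 in
/-- Discrete Hopf-type lower bound: a monotone solution of a lattice diffusion which grows by a
definite amount across an interval has increments bounded below at later times. -/
lemma lattice_increment_lower_bound {w c : ℕ → ℤ → ℝ} {ℓ O : ℝ} {n k₀ : ℕ} {i₀ : ℤ}
    (hℓ : 0 < ℓ) (hℓ4 : ℓ ≤ 1 / 4) (hn : 16 ≤ ℓ * n) (hO : 0 ≤ O)
    (hc : ∀ k i, ℓ ≤ c k i ∧ c k i ≤ 1 / 4)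
    (hw : ∀ k i, w (k + 1) i = w k i + c k i * (w k (i + 1) - 2 * w k i + w k (i - 1)))
    (hf : ∀ k i, k₀ ≤ k → k ≤ k₀ + 31 * n ^ 2 → i₀ - 12 * n ≤ i → i ≤ i₀ + 12 * n →
      0 ≤ w k i - w k (i - 1))
    (hstart : n * O ≤ w k₀ (i₀ + n) - w k₀ (i₀ - n))
    {k : ℕ} {ξ : ℤ} (hk : k₀ + 30 * n ^ 2 ≤ k) (hk' : k ≤ k₀ + 31 * n ^ 2)
    (hξ : i₀ - n ≤ ξ) (hξ' : ξ ≤ i₀ + n) :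
    ℓ * rexp (-(496 / ℓ)) * O ≤ w k ξ - w k (ξ - 1) := by
  have hn1 : (1 : ℝ) ≤ n := by
    by_contra h
    push Not at h
    have : ℓ * n ≤ 1 / 4 * 1 := by gcongr
    linarith
  have hnZ : (1 : ℤ) ≤ n := by exact_mod_cast hn1
  obtain ⟨E, rfl⟩ : ∃ E, k = k₀ + E := ⟨k - k₀, by omega⟩
  have hE : 30 * n ^ 2 ≤ E := by omega
  have hE' : E ≤ 31 * n ^ 2 := by omega
  have hER : (30 * n ^ 2 : ℝ) ≤ E := by exact_mod_cast hE
  have hER' : (E : ℝ) ≤ 31 * n ^ 2 := by exact_mod_cast hE'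
  set m : ℝ := (n : ℝ) ^ 2 with hm
  have hm1 : 1 ≤ m := by nlinarith
  have hlm : 16 * n ≤ ℓ * m := by nlinarith
  have hlm0 : 0 < ℓ * m := by positivity
  obtain ⟨B, hB⟩ : ∃ B : ℝ → ℝ, ∀ q, B q = q + q ^ 2 / (ℓ * m) := ⟨_, fun _ => rfl⟩
  set κ : ℝ := 8 / (ℓ * m) with hκ
  have hκ2 : κ ≤ 1 / 2 := by
    rw [hκ, div_le_div_iff₀ hlm0 two_pos]; nlinarith
  have hκ0 : 0 ≤ κ := by positivity
  have mono : ∀ k i j, k₀ ≤ k → k ≤ k₀ + 31 * n ^ 2 → i₀ - 12 * n ≤ j → j ≤ i → i ≤ i₀ + 12 * n →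
      0 ≤ w k i - w k j := by
    intro k i j h1 h2 h3 h4 h5
    have := int_le_increment (g := w k) (C := 0) h4 fun l hl hl' => by
      have := hf k (l + 1) h1 h2 (by omega) (by omega)
      simpa using this
    linarith
  set a : ℝ := ℓ * O / (6 * n) with ha
  have ha0 : 0 ≤ a := by positivity
  obtain ⟨Q, hQ⟩ : ∃ Q : ℕ → ℤ → ℤ → ℝ, ∀ e i j, Q e i j = 32 * m - (E - e)
      - (i - (ξ + 4 * n)) ^ 2 - (j - (ξ - 4 * n)) ^ 2 := ⟨_, fun _ _ _ => rfl⟩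
  have hξR : (i₀ : ℝ) - n ≤ ξ := by exact_mod_cast hξ
  have hξR' : (ξ : ℝ) ≤ i₀ + n := by exact_mod_cast hξ'
  have region : ∀ (e : ℕ) i j, e ≤ E → 0 ≤ Q e i j →
      |(i : ℝ) - (ξ + 4 * n)| ≤ 6 * n ∧ |(j : ℝ) - (ξ - 4 * n)| ≤ 6 * n ∧ j ≤ i ∧
        (0 < Q e i j → j < i) := by
    intro e i j he hq
    have heR : (e : ℝ) ≤ E := by exact_mod_cast he
    rw [hQ] at hq ⊢
    refine ⟨abs_le_of_sq_le_sq (by nlinarith) (by positivity),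
      abs_le_of_sq_le_sq (by nlinarith) (by positivity), ?_, ?_⟩
    · by_contra h
      have h : i + 1 ≤ j := by omega
      have h : (i : ℝ) + 1 ≤ j := by exact_mod_cast h
      nlinarith [sq_nonneg (((ξ:ℝ) + 4 * n - i) - (j - (ξ - 4 * n)))]
    · intro hq'
      by_contra h
      have h : i ≤ j := by omega
      have h : (i : ℝ) ≤ j := by exact_mod_cast h
      nlinarith [sq_nonneg (((ξ:ℝ) + 4 * n - i) - (j - (ξ - 4 * n)))]
  have range : ∀ i : ℤ, (|(i : ℝ) - (ξ + 4 * n)| ≤ 6 * n ∨ |(i : ℝ) - (ξ - 4 * n)| ≤ 6 * n) →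
      i₀ - 12 * n + 1 ≤ i ∧ i ≤ i₀ + 12 * n - 1 := by
    intro i hi
    have h : ((i₀ - 12 * n + 1 : ℤ) : ℝ) ≤ i ∧ (i : ℝ) ≤ ((i₀ + 12 * n - 1 : ℤ) : ℝ) := by
      push_cast
      rcases hi with hi | hi <;> rw [abs_le] at hi <;> constructor <;> linarith
    exact ⟨by exact_mod_cast h.1, by exact_mod_cast h.2⟩
  have hBneg : ∀ q : ℝ, q ≤ 0 → -(14 * n) ≤ q → B q ≤ 0 := by
    intro q hq hq'
    rw [hB]
    have : q ^ 2 / (ℓ * m) ≤ -q := by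
      rw [div_le_iff₀ hlm0]; nlinarith
    linarith
  have main : ∀ e : ℕ, e ≤ E → ∀ i j, 0 ≤ Q e i j →
      a * (1 - κ) ^ e * B (Q e i j) ≤ w (k₀ + e) i - w (k₀ + e) j := by
    intro e
    induction e with
    | zero =>
      intro _ i j hq
      obtain ⟨h1, h2, h3, -⟩ := region 0 i j (by omega) hq
      have hq2 : Q 0 i j ≤ 2 * m := by
        rw [hQ]; push_cast
        nlinarith [sq_nonneg ((i:ℝ) - (ξ + 4 * n)), sq_nonneg ((j:ℝ) - (ξ - 4 * n))]
      have hi : (i₀ : ℝ) + n ≤ i := by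
        by_contra h
        push Not at h
        have : 2 * (n : ℝ) < ξ + 4 * n - i := by linarith
        rw [hQ] at hq; push_cast at hq
        nlinarith [sq_nonneg ((j:ℝ) - (ξ - 4 * n))]
      have hj : (j : ℝ) ≤ i₀ - n := by
        by_contra h
        push Not at h
        have : 2 * (n : ℝ) < j - (ξ - 4 * n) := by linarith
        rw [hQ] at hq; push_cast at hq
        nlinarith [sq_nonneg ((i:ℝ) - (ξ + 4 * n))]
      have hi : i₀ + n ≤ i := by exact_mod_cast hi
      have hj : j ≤ i₀ - n := by exact_mod_cast hj
      have r1 := range i (.inl h1)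
      have r2 := range j (.inr h2)
      have m1 := mono k₀ i (i₀ + n) le_rfl (by omega) (by omega) hi (by omega)
      have m2 := mono k₀ (i₀ - n) j le_rfl (by omega) (by omega) hj (by omega)
      have hBq : B (Q 0 i j) ≤ 6 / ℓ * m := by
        rw [hB]
        have : Q 0 i j ^ 2 / (ℓ * m) ≤ (2 * m) ^ 2 / (ℓ * m) := by gcongr
        have e2 : (2 * m) ^ 2 / (ℓ * m) = 4 / ℓ * m := by field_simp; ring
        have e3 : 2 * m ≤ 2 / ℓ * m := by
          gcongr; rw [le_div_iff₀ hℓ]; linarith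
        calc _ ≤ 2 / ℓ * m + 4 / ℓ * m := by linarith
          _ = _ := by ring
      have : a * B (Q 0 i j) ≤ a * (6 / ℓ * m) := by gcongr
      have e4 : a * (6 / ℓ * m) = n * O := by rw [ha, hm]; field_simp
      simp only [pow_zero, mul_one, add_zero]
      linarith
    | succ e ih =>
      intro he i j hp
      have ih := ih (by omega)
      obtain ⟨h1, h2, h3, h4⟩ := region (e + 1) i j he hp
      have r1 := range i (.inl h1)
      have r2 := range j (.inr h2)
      rcases hp.eq_or_lt with hp0 | hp0
      · have := mono (k₀ + (e + 1)) i j (by omega) (by omega) (by omega) h3 (by omega)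
        rw [← hp0, hB]; simpa using this
      have hij := h4 hp0
      set p := Q (e + 1) i j with hpdef
      set x : ℝ := i - (ξ + 4 * n) with hx
      set y : ℝ := j - (ξ - 4 * n) with hy
      have hpe : p = 32 * m - (E - (e + 1)) - x ^ 2 - y ^ 2 := by rw [hpdef, hQ]; push_cast; rfl
      have comp : ∀ i' j', j' ≤ i' → i₀ - 12 * n ≤ j' → i' ≤ i₀ + 12 * n → -(14 * n) ≤ Q e i' j' →
          a * (1 - κ) ^ e * B (Q e i' j') ≤ w (k₀ + e) i' - w (k₀ + e) j' := by
        intro i' j' g1 g2 g3 g4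
        rcases le_total 0 (Q e i' j') with h | h
        · exact ih i' j' h
        · refine le_trans ?_ (mono (k₀ + e) i' j' (by omega) (by omega) g2 g1 g3)
          exact mul_nonpos_of_nonneg_of_nonpos
            (mul_nonneg ha0 (pow_nonneg (by linarith) _)) (hBneg _ h g4)
      rw [abs_le] at h1 h2
      have q0 : Q e i j = p - 1 := by rw [hQ, hpe]; ring
      have q1 : Q e (i + 1) j = p - 2 - 2 * x := by rw [hQ, hpe, hx]; push_cast; ring
      have q2 : Q e (i - 1) j = p - 2 + 2 * x := by rw [hQ, hpe, hx]; push_cast; ring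
      have q3 : Q e i (j + 1) = p - 2 - 2 * y := by rw [hQ, hpe, hy]; push_cast; ring
      have q4 : Q e i (j - 1) = p - 2 + 2 * y := by rw [hQ, hpe, hy]; push_cast; ring
      have c0 := comp i j h3 (by omega) (by omega) (by rw [q0]; linarith)
      have c1 := comp (i + 1) j (by omega) (by omega) (by omega) (by rw [q1]; linarith)
      have c2 := comp (i - 1) j (by omega) (by omega) (by omega) (by rw [q2]; linarith)
      have c3 := comp i (j + 1) (by omega) (by omega) (by omega) (by rw [q3]; linarith)
      have c4 := comp i (j - 1) (by omega) (by omega) (by omega) (by rw [q4]; linarith)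
      rw [q0] at c0; rw [q1] at c1; rw [q2] at c2; rw [q3] at c3; rw [q4] at c4
      obtain ⟨ci, ci'⟩ := hc (k₀ + e) i
      obtain ⟨cj, cj'⟩ := hc (k₀ + e) j
      have heE : ((e : ℝ) + 1) ≤ E := by exact_mod_cast he
      have step := barrier_step (x := x) (y := y) hℓ (m := m) (by nlinarith) (by linarith) hp
        (by rw [hpe]; linarith [show (0:ℝ) ≤ e from Nat.cast_nonneg e]) hℓ4 ci ci' cj cj' hB
      have hg : 0 ≤ a * (1 - κ) ^ e := mul_nonneg ha0 (pow_nonneg (by linarith) _)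
      have step' := mul_le_mul_of_nonneg_left step hg
      have s0 := mul_le_mul_of_nonneg_left c0
        (show 0 ≤ 1 - 2 * c (k₀ + e) i - 2 * c (k₀ + e) j by linarith)
      have s1 := mul_le_mul_of_nonneg_left (add_le_add c1 c2) (hℓ.le.trans ci)
      have s2 := mul_le_mul_of_nonneg_left (add_le_add c3 c4) (hℓ.le.trans cj)
      have e5 : a * (1 - κ) ^ (e + 1) * B p = a * (1 - κ) ^ e * ((1 - κ) * B p) := by ring
      rw [← add_assoc, hw, hw (k₀ + e) j, e5]
      refine step'.trans ?_
      linarith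
  have hQE : Q E ξ (ξ - 1) = 8 * n - 1 := by rw [hQ, hm]; push_cast; ring
  have fin := main E le_rfl ξ (ξ - 1) (by rw [hQE]; linarith)
  rw [hQE] at fin
  refine le_trans ?_ fin
  have hB6 : 6 * n ≤ B (8 * n - 1) := by
    rw [hB]
    have : 0 ≤ (8 * (n : ℝ) - 1) ^ 2 / (ℓ * m) := by positivity
    linarith
  have hexp : rexp (-(2 * κ)) ≤ 1 - κ := by
    rw [Real.exp_neg, inv_le_comm₀ (Real.exp_pos _) (by linarith)]
    refine le_trans ?_ (Real.add_one_le_exp _)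
    rw [inv_le_iff_one_le_mul₀ (by linarith)]
    nlinarith
  have hG : rexp (-(496 / ℓ)) ≤ (1 - κ) ^ E := by
    refine le_trans ?_ (pow_le_pow_left₀ (Real.exp_pos _).le hexp E)
    rw [← Real.exp_nat_mul, Real.exp_le_exp]
    have : κ * (31 * m) = 248 / ℓ := by rw [hκ]; field_simp; norm_num
    have h2 : κ * E ≤ κ * (31 * m) := by gcongr
    have h3 : 496 / ℓ = 2 * (248 / ℓ) := by ring
    linarith
  have e6 : ℓ * rexp (-(496 / ℓ)) * O = a * rexp (-(496 / ℓ)) * (6 * n) := by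
    rw [ha]; field_simp
  rw [e6]
  exact mul_le_mul (mul_le_mul_of_nonneg_left hG ha0) hB6 (by positivity)
    (mul_nonneg ha0 (pow_nonneg (by linarith) _))

lemma lattice_osc_step {w c : ℕ → ℤ → ℝ} {ℓ m O : ℝ} {n kₑ : ℕ} {i₀ : ℤ}
    (hℓ : 0 < ℓ) (hℓ4 : ℓ ≤ 1 / 4) (hn : 16 ≤ ℓ * n) (hO : 0 ≤ O)
    (hc : ∀ k i, ℓ ≤ c k i ∧ c k i ≤ 1 / 4)
    (hw : ∀ k i, w (k + 1) i = w k i + c k i * (w k (i + 1) - 2 * w k i + w k (i - 1)))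
    (hk : (12 * n) ^ 2 ≤ kₑ)
    (hf : ∀ (k : ℕ) (i : ℤ), k ≤ kₑ → kₑ ≤ k + (12 * n) ^ 2 → |i - i₀| ≤ 12 * n →
      m ≤ w k i - w k (i - 1) ∧ w k i - w k (i - 1) ≤ m + O) :
    ∃ m', ∀ (k : ℕ) (i : ℤ), k ≤ kₑ → kₑ ≤ k + n ^ 2 → |i - i₀| ≤ n →
      m' ≤ w k i - w k (i - 1) ∧
        w k i - w k (i - 1) ≤ m' + (1 - ℓ * rexp (-(496 / ℓ))) * O := by
  set δ := ℓ * rexp (-(496 / ℓ)) with hδ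
  have e0 : (12 * n) ^ 2 = 144 * n ^ 2 := by ring
  rw [e0] at hk hf
  obtain ⟨k₀, rfl⟩ : ∃ k₀, kₑ = k₀ + 31 * n ^ 2 := ⟨kₑ - 31 * n ^ 2, by omega⟩
  have hfm : ∀ (k : ℕ) (i : ℤ), k₀ ≤ k → k ≤ k₀ + 31 * n ^ 2 → i₀ - 12 * n ≤ i →
      i ≤ i₀ + 12 * n → m ≤ w k i - w k (i - 1) ∧ w k i - w k (i - 1) ≤ m + O :=
    fun k i h1 h2 h3 h4 => hf k i h2 (by omega) (abs_le.2 ⟨by linarith, by linarith⟩)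
  have lower : ∀ (k : ℕ) (i : ℤ), k ≤ k₀ + 31 * n ^ 2 → k₀ + 31 * n ^ 2 ≤ k + n ^ 2 →
      |i - i₀| ≤ n → m ≤ w k i - w k (i - 1) ∧ w k i - w k (i - 1) ≤ m + O := by
    intro k i h1 h2 h3
    rw [abs_le] at h3
    exact hfm k i (by omega) h1 (by omega) (by omega)
  rcases le_total (n * (2 * m + O)) (w k₀ (i₀ + n) - w k₀ (i₀ - n)) with h | h
  · refine ⟨m + δ * O, fun k i h1 h2 h3 => ⟨?_, by linarith [(lower k i h1 h2 h3).2]⟩⟩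
    rw [abs_le] at h3
    have := lattice_increment_lower_bound (w := fun k i => w k i - m * i) (O := O) (k₀ := k₀)
      (i₀ := i₀) (ξ := i) (k := k) hℓ hℓ4 hn hO hc
      (fun k i => by simp only [hw k i]; push_cast; ring)
      (fun k i g1 g2 g3 g4 => by
        have := (hfm k i g1 g2 g3 g4).1
        push_cast; linarith)
      (by push_cast; linarith) (by omega) h1 (by omega) (by omega)
    push_cast at this
    linarith
  · refine ⟨m, fun k i h1 h2 h3 => ⟨(lower k i h1 h2 h3).1, ?_⟩⟩
    rw [abs_le] at h3
    have := lattice_increment_lower_bound (w := fun k i => (m + O) * i - w k i) (O := O) (k₀ := k₀)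
      (i₀ := i₀) (ξ := i) (k := k) hℓ hℓ4 hn hO hc
      (fun k i => by simp only [hw k i]; push_cast; ring)
      (fun k i g1 g2 g3 g4 => by
        have := (hfm k i g1 g2 g3 g4).2
        push_cast; linarith)
      (by push_cast; linarith) (by omega) h1 (by omega) (by omega)
    push_cast at this
    linarith

lemma lattice_osc_decay {w c : ℕ → ℤ → ℝ} {ℓ : ℝ} {n kₑ : ℕ} {i₀ : ℤ}
    (hℓ : 0 < ℓ) (hℓ4 : ℓ ≤ 1 / 4) (hn : 16 ≤ ℓ * n)
    (hc : ∀ k i, ℓ ≤ c k i ∧ c k i ≤ 1 / 4)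
    (hw : ∀ k i, w (k + 1) i = w k i + c k i * (w k (i + 1) - 2 * w k i + w k (i - 1)))
    (j : ℕ) {m O : ℝ} (hO : 0 ≤ O) (hk : (12 ^ j * n) ^ 2 ≤ kₑ)
    (hf : ∀ (k : ℕ) (i : ℤ), m ≤ w k i - w k (i - 1) ∧ w k i - w k (i - 1) ≤ m + O) :
    ∃ m', ∀ (k : ℕ) (i : ℤ), k ≤ kₑ → kₑ ≤ k + n ^ 2 → |i - i₀| ≤ n →
      m' ≤ w k i - w k (i - 1) ∧
        w k i - w k (i - 1) ≤ m' + (1 - ℓ * rexp (-(496 / ℓ))) ^ j * O := by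
  have hδ1 : ℓ * rexp (-(496 / ℓ)) ≤ 1 := by
    have : rexp (-(496 / ℓ)) ≤ 1 := Real.exp_le_one_iff.2 (by simp only [neg_nonpos]; positivity)
    nlinarith [Real.exp_pos (-(496 / ℓ))]
  induction j generalizing n with
  | zero => exact ⟨m, fun k i _ _ _ => by simpa using hf k i⟩
  | succ j ih =>
    have e1 : 12 ^ j * (12 * n) = 12 ^ (j + 1) * n := by ring
    obtain ⟨m', hm'⟩ := ih (n := 12 * n) (by push_cast; nlinarith) (by rw [e1]; exact hk)
    obtain ⟨m'', hm''⟩ := lattice_osc_step (m := m') (i₀ := i₀) hℓ hℓ4 hn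
      (mul_nonneg (pow_nonneg (sub_nonneg.2 hδ1) j) hO) hc hw
      (le_trans (Nat.pow_le_pow_left (by
        rw [← e1]; exact Nat.le_mul_of_pos_left _ (by positivity)) 2) hk)
      (fun k i h1 h2 h3 => hm' k i h1 h2 (by push_cast; exact h3))
    refine ⟨m'', fun k i h1 h2 h3 => ?_⟩
    rw [pow_succ', mul_assoc]
    exact hm'' k i h1 h2 h3

/-- Forward difference quotient on a grid of mesh `h`. -/
noncomputable def latSlope (h : ℝ) (U : ℤ → ℝ) (i : ℤ) : ℝ := (U (i + 1) - U i) / h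

/-- Discretisation of `∂ₓ (A (∂ₓ u))` on a grid of mesh `h`. -/
noncomputable def latFlux (A : ℝ → ℝ) (h : ℝ) (U : ℤ → ℝ) (i : ℤ) : ℝ :=
  (A (latSlope h U i) - A (latSlope h U (i - 1))) / h

/-- The explicit Euler scheme for `∂ₜ u = ∂ₓ (A (∂ₓ u))`. -/
noncomputable def latEvolve (A : ℝ → ℝ) (Lam h : ℝ) (G : ℤ → ℝ) : ℕ → ℤ → ℝ
  | 0 => G
  | k + 1 => fun i => latEvolve A Lam h G k i
      + h ^ 2 / (4 * Lam) * latFlux A h (latEvolve A Lam h G k) i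

/-- Two-sided bounds on the difference quotients of `A`. -/
def SlopesIn (A : ℝ → ℝ) (lam Lam : ℝ) : Prop :=
  ∀ p q, ∃ a, lam ≤ a ∧ a ≤ Lam ∧ A p - A q = a * (p - q)

/-- Odd periodic grid data, concave on a half period, with bounds on first and second
differences. -/
structure LatticeData (h K B M : ℝ) (N : ℕ) (G : ℤ → ℝ) : Prop where
  odd : ∀ i, G (-i) = -G i
  per : ∀ i, G (i + 2 * N) = G i
  lip : ∀ i, |G (i + 1) - G i| ≤ K * h
  sec : ∀ i, |G (i + 1) - 2 * G i + G (i - 1)| ≤ B * h ^ 2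
  conc : ∀ i : ℤ, 0 ≤ i → i ≤ N → G (i + 1) - 2 * G i + G (i - 1) ≤ 0
  nonneg : ∀ i : ℤ, 0 ≤ i → i ≤ N → 0 ≤ G i
  le : ∀ i : ℤ, 0 ≤ i → i ≤ N → G i ≤ M

/-- The properties of a solution of the explicit scheme that are uniform in the mesh. -/
structure LatticeSol (A : ℝ → ℝ) (lam Lam h K F M : ℝ) (N : ℕ) (U : ℕ → ℤ → ℝ) : Prop where
  step : ∀ k i, U (k + 1) i = U k i + h ^ 2 / (4 * Lam) * latFlux A h (U k) i
  odd : ∀ k i, U k (-i) = -U k i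
  per : ∀ k i, U k (i + 2 * N) = U k i
  slope_le : ∀ k i, |latSlope h (U k) i| ≤ K
  flux_le : ∀ k i, |latFlux A h (U k) i| ≤ F
  flux_nonpos : ∀ (k : ℕ) (i : ℤ), 0 ≤ i → i ≤ N → latFlux A h (U k) i ≤ 0
  nonneg : ∀ (k : ℕ) (i : ℤ), 0 ≤ i → i ≤ N → 0 ≤ U k i
  le : ∀ (k : ℕ) (i : ℤ), 0 ≤ i → i ≤ N → U k i ≤ M
  lin : ∃ c : ℕ → ℤ → ℝ, (∀ k i, lam / (4 * Lam) ≤ c k i ∧ c k i ≤ 1 / 4) ∧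
    ∀ k i, A (latSlope h (U (k + 1)) i) / h = A (latSlope h (U k) i) / h
      + c k i * (A (latSlope h (U k) (i + 1)) / h - 2 * (A (latSlope h (U k) i) / h)
        + A (latSlope h (U k) (i - 1)) / h)

section
variable {A : ℝ → ℝ} {lam Lam h K B F M : ℝ} {N : ℕ}

lemma latFlux_eq_sub (U : ℤ → ℝ) (i : ℤ) :
    latFlux A h U i = A (latSlope h U i) / h - A (latSlope h U (i - 1)) / h := by
  rw [latFlux, sub_div]

lemma latFlux_neg {U : ℤ → ℝ} (hU : ∀ i, U (-i) = -U i) (i : ℤ) :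
    latFlux A h U (-i) = -latFlux A h U i := by
  have h1 : ∀ i, latSlope h U (-i) = latSlope h U (i - 1) := by
    intro i
    have := hU (i - 1)
    rw [show -(i - 1) = -i + 1 by ring] at this
    rw [latSlope, latSlope, this, hU, sub_add_cancel]; ring
  have h2 := h1 (i + 1)
  rw [add_sub_cancel_right, show -(i + 1) = -i - 1 by ring] at h2
  rw [latFlux, latFlux, h1, h2]; ring

lemma latFlux_add_period {U : ℤ → ℝ} (hU : ∀ i, U (i + 2 * N) = U i) (i : ℤ) :
    latFlux A h U (i + 2 * N) = latFlux A h U i := by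
  have h1 : ∀ i, latSlope h U (i + 2 * N) = latSlope h U i := by
    intro i
    rw [latSlope, latSlope, hU, show i + 2 * (N : ℤ) + 1 = i + 1 + 2 * N by ring, hU]
  rw [latFlux, latFlux, h1, show i + 2 * (N : ℤ) - 1 = i - 1 + 2 * N by ring, h1]

lemma convex_step_le {a b x y z C : ℝ} (ha : 0 ≤ a) (ha' : a ≤ 1 / 4) (hb : 0 ≤ b)
    (hb' : b ≤ 1 / 4) (hx : x ≤ C) (hy : y ≤ C) (hz : z ≤ C) :
    x + a * (y - x) - b * (x - z) ≤ C := by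
  nlinarith [mul_nonneg ha (sub_nonneg.2 hy), mul_nonneg hb (sub_nonneg.2 hz),
    mul_nonneg (sub_nonneg.2 hx) (show 0 ≤ 1 - a - b by linarith)]

lemma le_convex_step {a b x y z C : ℝ} (ha : 0 ≤ a) (ha' : a ≤ 1 / 4) (hb : 0 ≤ b)
    (hb' : b ≤ 1 / 4) (hx : C ≤ x) (hy : C ≤ y) (hz : C ≤ z) :
    C ≤ x + a * (y - x) - b * (x - z) := by
  have := convex_step_le ha ha' hb hb' (neg_le_neg hx) (neg_le_neg hy) (neg_le_neg hz)
  linarith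

lemma LatticeData.latticeSol (hA : SlopesIn A lam Lam) (hlam : 0 < lam) (hLam : 0 < Lam)
    (hh : 0 < h) {G : ℤ → ℝ} (hG : LatticeData h K B M N G) :
    LatticeSol A lam Lam h K (Lam * B) M N (latEvolve A Lam h G) := by
  set U := latEvolve A Lam h G with hUdef
  have step : ∀ k i, U (k + 1) i = U k i + h ^ 2 / (4 * Lam) * latFlux A h (U k) i :=
    fun k i => rfl
  have U0 : U 0 = G := rfl
  have odd : ∀ k i, U k (-i) = -U k i := by
    intro k
    induction k with
    | zero => exact hG.odd
    | succ k ih => intro i; rw [step, step, ih, latFlux_neg ih]; ring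
  have per : ∀ k i, U k (i + 2 * N) = U k i := by
    intro k
    induction k with
    | zero => exact hG.per
    | succ k ih => intro i; rw [step, step, ih, latFlux_add_period ih]
  have coef : ∀ p q, ∃ c, lam / (4 * Lam) ≤ c ∧ c ≤ 1 / 4 ∧ A p - A q = 4 * Lam * c * (p - q) := by
    intro p q
    obtain ⟨a, h1, h2, h3⟩ := hA p q
    refine ⟨a / (4 * Lam), by gcongr, ?_, ?_⟩
    · rw [div_le_iff₀ (by positivity)]; linarith
    · rw [h3]; field_simp
  have lpos : 0 < lam / (4 * Lam) := by positivity
  have slope_step : ∀ k i, latSlope h (U (k + 1)) i = latSlope h (U k) i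
      + h / (4 * Lam) * (latFlux A h (U k) (i + 1) - latFlux A h (U k) i) := by
    intro k i
    simp only [latSlope, step]
    field_simp
    ring
  have lin : ∃ c : ℕ → ℤ → ℝ, (∀ k i, lam / (4 * Lam) ≤ c k i ∧ c k i ≤ 1 / 4) ∧
    ∀ k i, A (latSlope h (U (k + 1)) i) / h = A (latSlope h (U k) i) / h
      + c k i * (A (latSlope h (U k) (i + 1)) / h - 2 * (A (latSlope h (U k) i) / h)
        + A (latSlope h (U k) (i - 1)) / h) := by
    choose c h1 h2 h3 using fun (k : ℕ) (i : ℤ) =>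
      coef (latSlope h (U (k + 1)) i) (latSlope h (U k) i)
    refine ⟨c, fun k i => ⟨h1 k i, h2 k i⟩, fun k i => ?_⟩
    have e := h3 k i
    have hs := slope_step k i
    rw [latFlux_eq_sub, latFlux_eq_sub, add_sub_cancel_right, ← sub_eq_iff_eq_add'] at hs
    rw [hs] at e
    rw [sub_eq_iff_eq_add.1 e]
    generalize A (latSlope h (U k) (i + 1)) = a1, A (latSlope h (U k) i) = a2,
      A (latSlope h (U k) (i - 1)) = a3
    field_simp
    ring
  obtain ⟨c, hc, hlin⟩ := id lin
  have flux_step : ∀ k i, latFlux A h (U (k + 1)) i = latFlux A h (U k) i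
      + c k i * (latFlux A h (U k) (i + 1) - latFlux A h (U k) i)
      - c k (i - 1) * (latFlux A h (U k) i - latFlux A h (U k) (i - 1)) := by
    intro k i
    simp only [latFlux_eq_sub, hlin, add_sub_cancel_right, sub_add_cancel]
    ring
  have slope_le : ∀ k i, |latSlope h (U k) i| ≤ K := by
    intro k
    induction k with
    | zero =>
      intro i
      rw [U0, latSlope, abs_div, abs_of_pos hh, div_le_iff₀ hh]
      exact hG.lip i
    | succ k ih =>
      intro i
      obtain ⟨a, a1, a2, a3⟩ := coef (latSlope h (U k) (i + 1)) (latSlope h (U k) i)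
      obtain ⟨b, b1, b2, b3⟩ := coef (latSlope h (U k) i) (latSlope h (U k) (i - 1))
      have e : latSlope h (U (k + 1)) i = latSlope h (U k) i
          + a * (latSlope h (U k) (i + 1) - latSlope h (U k) i)
          - b * (latSlope h (U k) i - latSlope h (U k) (i - 1)) := by
        rw [slope_step, latFlux, latFlux, add_sub_cancel_right, a3, b3]
        field_simp
        ring
      rw [e, abs_le]
      have x := abs_le.1 (ih i)
      have y := abs_le.1 (ih (i + 1))
      have z := abs_le.1 (ih (i - 1))
      exact ⟨le_convex_step (by linarith) a2 (by linarith) b2 x.1 y.1 z.1,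
        convex_step_le (by linarith) a2 (by linarith) b2 x.2 y.2 z.2⟩
  have flux_le : ∀ k i, |latFlux A h (U k) i| ≤ Lam * B := by
    intro k
    induction k with
    | zero =>
      intro i
      obtain ⟨a, a1, a2, a3⟩ := hA (latSlope h G i) (latSlope h G (i - 1))
      have e : latFlux A h G i = a * ((G (i + 1) - 2 * G i + G (i - 1)) / h ^ 2) := by
        rw [latFlux, a3, latSlope, latSlope, sub_add_cancel]; field_simp; ring
      have h2 : |(G (i + 1) - 2 * G i + G (i - 1)) / h ^ 2| ≤ B := by
        rw [abs_div, abs_of_pos (by positivity : 0 < h ^ 2), div_le_iff₀ (by positivity)]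
        exact hG.sec i
      rw [U0, e, abs_mul, abs_of_pos (hlam.trans_le a1)]
      gcongr
    | succ k ih =>
      intro i
      rw [flux_step, abs_le]
      have x := abs_le.1 (ih i)
      have y := abs_le.1 (ih (i + 1))
      have z := abs_le.1 (ih (i - 1))
      have c1 := hc k i
      have c2 := hc k (i - 1)
      exact ⟨le_convex_step (by linarith) c1.2 (by linarith) c2.2 x.1 y.1 z.1,
        convex_step_le (by linarith) c1.2 (by linarith) c2.2 x.2 y.2 z.2⟩
  have flux_zero : ∀ k, latFlux A h (U k) 0 = 0 := by
    intro k
    have := latFlux_neg (A := A) (h := h) (odd k) 0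
    rw [neg_zero] at this; linarith
  have flux_N : ∀ k, latFlux A h (U k) N = 0 := by
    intro k
    have h1 := latFlux_neg (A := A) (h := h) (odd k) N
    have h2 := latFlux_add_period (A := A) (h := h) (per k) (-N)
    rw [show -(N : ℤ) + 2 * N = N by ring] at h2; linarith
  have U_zero : ∀ k, U k 0 = 0 := by
    intro k
    have := odd k 0
    rw [neg_zero] at this; linarith
  have U_N : ∀ k, U k N = 0 := by
    intro k
    have h1 := odd k N
    have h2 := per k (-N)
    rw [show -(N : ℤ) + 2 * N = N by ring] at h2; linarith
  have flux_nonpos : ∀ (k : ℕ) (i : ℤ), 0 ≤ i → i ≤ N → latFlux A h (U k) i ≤ 0 := by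
    intro k
    induction k with
    | zero =>
      intro i hi hi'
      obtain ⟨a, a1, a2, a3⟩ := hA (latSlope h G i) (latSlope h G (i - 1))
      have e : latFlux A h G i = a * ((G (i + 1) - 2 * G i + G (i - 1)) / h ^ 2) := by
        rw [latFlux, a3, latSlope, latSlope, sub_add_cancel]; field_simp; ring
      rw [U0, e]
      exact mul_nonpos_of_nonneg_of_nonpos (hlam.le.trans a1)
        (div_nonpos_of_nonpos_of_nonneg (hG.conc i hi hi') (by positivity))
    | succ k ih =>
      intro i hi hi'
      rcases hi.eq_or_lt with rfl | hi
      · rw [flux_zero]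
      rcases hi'.eq_or_lt with rfl | hi'
      · rw [flux_N]
      rw [flux_step]
      have c1 := hc k i
      have c2 := hc k (i - 1)
      exact convex_step_le (by linarith) c1.2 (by linarith) c2.2 (ih i (by omega) (by omega))
        (ih (i + 1) (by omega) (by omega)) (ih (i - 1) (by omega) (by omega))
  refine ⟨step, odd, per, slope_le, flux_le, flux_nonpos, ?_, ?_, lin⟩
  · intro k
    induction k with
    | zero => exact hG.nonneg
    | succ k ih =>
      intro i hi hi'
      rcases hi.eq_or_lt with rfl | hi
      · rw [U_zero]
      rcases hi'.eq_or_lt with rfl | hi'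
      · rw [U_N]
      obtain ⟨a, a1, a2, a3⟩ := coef (latSlope h (U k) i) 0
      obtain ⟨b, b1, b2, b3⟩ := coef (latSlope h (U k) (i - 1)) 0
      have e : U (k + 1) i = U k i + a * (U k (i + 1) - U k i) - b * (U k i - U k (i - 1)) := by
        rw [step, latFlux, sub_eq_iff_eq_add.1 a3, sub_eq_iff_eq_add.1 b3, latSlope, latSlope,
          sub_add_cancel]
        field_simp
        ring
      rw [e]
      exact le_convex_step (by linarith) a2 (by linarith) b2 (ih i (by omega) (by omega))
        (ih (i + 1) (by omega) (by omega)) (ih (i - 1) (by omega) (by omega))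
  · intro k
    induction k with
    | zero => exact hG.le
    | succ k ih =>
      intro i hi hi'
      rw [step]
      have := mul_nonpos_of_nonneg_of_nonpos (show 0 ≤ h ^ 2 / (4 * Lam) by positivity)
        (flux_nonpos k i hi hi')
      linarith [ih i hi hi']

end

lemma int_increment_abs {g : ℤ → ℝ} {a C : ℝ} {i j : ℤ}
    (hg : ∀ l, min i j ≤ l → l < max i j → |g (l + 1) - g l - a| ≤ C) :
    |g j - g i - a * (j - i)| ≤ C * |(j : ℝ) - i| := by
  wlog hij : i ≤ j generalizing i j
  · have := this (i := j) (j := i) (by rwa [min_comm, max_comm]) (by omega)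
    rw [abs_sub_comm (j : ℝ), ← abs_neg]
    convert this using 2
    ring
  rw [min_eq_left hij, max_eq_right hij] at hg
  have h1 : (0 : ℝ) ≤ j - i := by exact_mod_cast sub_nonneg.2 hij
  have h2 := int_increment_le (g := g) (C := a + C) hij fun l hl hl' => by
    linarith [(abs_le.1 (hg l hl hl')).2]
  have h3 := int_le_increment (g := g) (C := a - C) hij fun l hl hl' => by
    linarith [(abs_le.1 (hg l hl hl')).1]
  rw [abs_of_nonneg h1, abs_le]
  constructor <;> linarith

lemma nat_increment_abs {g : ℕ → ℝ} {a C : ℝ} {i j : ℕ}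
    (hg : ∀ l, min i j ≤ l → l < max i j → |g (l + 1) - g l - a| ≤ C) :
    |g j - g i - a * (j - i)| ≤ C * |(j : ℝ) - i| := by
  have := int_increment_abs (g := fun l => g l.toNat) (a := a) (C := C) (i := i) (j := j)
    fun l hl hl' => by
      obtain ⟨l, rfl⟩ := Int.eq_ofNat_of_zero_le (a := l) (by omega)
      have := hg l (by omega) (by omega)
      simpa using this
  simpa using this

lemma floor_div_sub {h : ℝ} (hh : 0 < h) (x y : ℝ) :
    |h * ((⌊y / h⌋ : ℝ) - ⌊x / h⌋) - (y - x)| ≤ h := by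
  have e1 : x = h * (x / h) := by field_simp
  have e2 : y = h * (y / h) := by field_simp
  have h1 := Int.floor_le (x / h)
  have h2 := Int.lt_floor_add_one (x / h)
  have h3 := Int.floor_le (y / h)
  have h4 := Int.lt_floor_add_one (y / h)
  conv_lhs => rw [e1, e2, ← mul_sub, ← mul_sub, ← e1, ← e2, abs_mul, abs_of_pos hh]
  have : |((⌊y / h⌋ : ℝ) - ⌊x / h⌋) - (y / h - x / h)| ≤ 1 := by
    rw [abs_le]; constructor <;> linarith
  nlinarith

lemma natFloor_div_sub {h : ℝ} (hh : 0 < h) {x y : ℝ} (hx : 0 ≤ x) (hy : 0 ≤ y) :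
    |h * ((⌊y / h⌋₊ : ℝ) - ⌊x / h⌋₊) - (y - x)| ≤ h := by
  have := floor_div_sub hh x y
  rwa [← Int.natCast_floor_eq_floor (by positivity), ← Int.natCast_floor_eq_floor (by positivity)]
    at this

lemma natFloor_div_dist {h : ℝ} (hh : 0 < h) (x y : ℝ) :
    h * |(⌊y / h⌋₊ : ℝ) - ⌊x / h⌋₊| ≤ |y - x| + h := by
  wlog hxy : x ≤ y generalizing x y
  · rw [abs_sub_comm, abs_sub_comm y]; exact this y x (le_of_not_ge hxy)
  have hmono : (⌊x / h⌋₊ : ℝ) ≤ ⌊y / h⌋₊ := by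
    exact_mod_cast Nat.floor_mono (by gcongr)
  rw [abs_of_nonneg (by linarith), abs_of_nonneg (by linarith)]
  rcases le_total 0 x with hx | hx
  · have := (abs_le.1 (natFloor_div_sub hh hx (hx.trans hxy))).2
    linarith
  · rw [Nat.floor_of_nonpos (div_nonpos_of_nonpos_of_nonneg hx hh.le)]
    rcases le_total 0 y with hy | hy
    · have := Nat.floor_le (div_nonneg hy hh.le)
      rw [le_div_iff₀ hh] at this
      simp only [Nat.cast_zero]
      linarith
    · rw [Nat.floor_of_nonpos (div_nonpos_of_nonpos_of_nonneg hy hh.le)]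
      simp; linarith

lemma floor_div_dist {h : ℝ} (hh : 0 < h) (x y : ℝ) :
    h * |(⌊y / h⌋ : ℝ) - ⌊x / h⌋| ≤ |y - x| + h := by
  have := floor_div_sub hh x y
  rw [← abs_of_pos hh, ← abs_mul, abs_of_pos hh]
  have h2 := abs_add_le (h * ((⌊y / h⌋ : ℝ) - ⌊x / h⌋) - (y - x)) (y - x)
  rw [sub_add_cancel] at h2
  linarith

section
variable {A : ℝ → ℝ} {lam Lam h K F M : ℝ} {N : ℕ} {U : ℕ → ℤ → ℝ}

lemma SlopesIn.abs_sub_le (hA : SlopesIn A lam Lam) (hlam : 0 < lam) (p q : ℝ) :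
    |p - q| ≤ |A p - A q| / lam := by
  obtain ⟨a, a1, a2, a3⟩ := hA p q
  rw [le_div_iff₀ hlam, a3, abs_mul, abs_of_pos (hlam.trans_le a1), mul_comm]
  gcongr

lemma SlopesIn.le_of_le (hA : SlopesIn A lam Lam) (hlam : 0 < lam) {p q : ℝ} (h : A p ≤ A q) :
    p ≤ q := by
  obtain ⟨a, a1, a2, a3⟩ := hA p q
  by_contra! hlt
  nlinarith [mul_pos (hlam.trans_le a1) (sub_pos.2 hlt)]

lemma sub_eq_latSlope (hh : 0 < h) (U : ℤ → ℝ) (i : ℤ) :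
    U (i + 1) - U i = h * latSlope h U i := by
  rw [latSlope]; field_simp

lemma A_latSlope_sub (hh : 0 < h) (U : ℤ → ℝ) (i : ℤ) :
    A (latSlope h U (i + 1)) - A (latSlope h U i) = h * latFlux A h U (i + 1) := by
  rw [latFlux, add_sub_cancel_right]; field_simp

namespace LatticeSol

lemma zero (hU : LatticeSol A lam Lam h K F M N U) (k : ℕ) : U k 0 = 0 := by
  have := hU.odd k 0
  rw [neg_zero] at this; linarith

lemma half_period (hU : LatticeSol A lam Lam h K F M N U) (k : ℕ) : U k N = 0 := by
  have h1 := hU.odd k N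
  have h2 := hU.per k (-N)
  rw [show -(N : ℤ) + 2 * N = N by ring] at h2; linarith

lemma flux_nonneg (hU : LatticeSol A lam Lam h K F M N U)
    (i : ℤ) (k : ℕ) : 0 ≤ F := (abs_nonneg _).trans (hU.flux_le k i)

lemma abs_sub_space (hU : LatticeSol A lam Lam h K F M N U) (hh : 0 < h) (k : ℕ) (x y : ℝ) :
    |U k ⌊y / h⌋ - U k ⌊x / h⌋| ≤ K * (|y - x| + h) := by
  have hK : 0 ≤ K := (abs_nonneg _).trans (hU.slope_le 0 0)
  have h1 := int_increment_abs (g := U k) (a := 0) (C := K * h) (i := ⌊x / h⌋) (j := ⌊y / h⌋)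
    fun l _ _ => by
      rw [sub_eq_latSlope hh, sub_zero, abs_mul, abs_of_pos hh, mul_comm]
      gcongr
      exact hU.slope_le k l
  have h2 := floor_div_dist hh x y
  calc _ ≤ K * (h * |(⌊y / h⌋ : ℝ) - ⌊x / h⌋|) := by simpa [mul_assoc] using h1
    _ ≤ _ := by gcongr

lemma abs_slope_sub_int (hU : LatticeSol A lam Lam h K F M N U)
    (hA : SlopesIn A lam Lam) (hlam : 0 < lam) (hh : 0 < h) (k : ℕ) (i j : ℤ) :
    |latSlope h (U k) j - latSlope h (U k) i| ≤ F / lam * (h * |(j : ℝ) - i|) := by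
  have hF : 0 ≤ F := hU.flux_nonneg 0 0
  have h1 := int_increment_abs (g := fun l => A (latSlope h (U k) l)) (a := 0) (C := F * h)
    (i := i) (j := j) fun l _ _ => by
      rw [A_latSlope_sub hh, sub_zero, abs_mul, abs_of_pos hh, mul_comm]
      gcongr
      exact hU.flux_le k _
  refine (hA.abs_sub_le hlam _ _).trans ?_
  rw [div_mul_eq_mul_div]
  gcongr
  simpa [mul_assoc] using h1

lemma abs_slope_sub (hU : LatticeSol A lam Lam h K F M N U)
    (hA : SlopesIn A lam Lam) (hlam : 0 < lam) (hh : 0 < h) (k : ℕ) (x y : ℝ) :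
    |latSlope h (U k) ⌊y / h⌋ - latSlope h (U k) ⌊x / h⌋| ≤ F / lam * (|y - x| + h) := by
  have hF : 0 ≤ F := hU.flux_nonneg 0 0
  refine (hU.abs_slope_sub_int hA hlam hh k _ _).trans ?_
  gcongr
  exact floor_div_dist hh x y

lemma taylor_space (hU : LatticeSol A lam Lam h K F M N U)
    (hA : SlopesIn A lam Lam) (hlam : 0 < lam) (hh : 0 < h) (k : ℕ) (x y : ℝ) :
    |U k ⌊y / h⌋ - U k ⌊x / h⌋ - (y - x) * latSlope h (U k) ⌊x / h⌋|
      ≤ F / lam * (|y - x| + h) ^ 2 + K * h := by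
  have hF : 0 ≤ F := hU.flux_nonneg 0 0
  have hK : 0 ≤ K := (abs_nonneg _).trans (hU.slope_le 0 0)
  set i := ⌊x / h⌋
  set j := ⌊y / h⌋
  have h1 := int_increment_abs (g := U k) (a := h * latSlope h (U k) i)
    (C := h * (F / lam * (h * |(j : ℝ) - i|))) (i := i) (j := j) fun l hl hl' => by
      rw [sub_eq_latSlope hh, ← mul_sub, abs_mul, abs_of_pos hh]
      gcongr
      refine (hU.abs_slope_sub_int hA hlam hh k _ _).trans ?_
      have : |(l : ℝ) - i| ≤ |(j : ℝ) - i| := by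
        norm_cast
        rcases le_total i j with hij | hij
        · rw [abs_of_nonneg (by omega), abs_of_nonneg (by omega)]; omega
        · rw [abs_of_nonpos (by omega), abs_of_nonpos (by omega)]; omega
      gcongr
  have h2 : h * |(j : ℝ) - i| ≤ |y - x| + h := floor_div_dist hh x y
  have h3 : |h * ((j : ℝ) - i) - (y - x)| ≤ h := floor_div_sub hh x y
  have h4 : h * (F / lam * (h * |(j : ℝ) - i|)) * |(j : ℝ) - i| ≤ F / lam * (|y - x| + h) ^ 2 :=
    calc _ = F / lam * (h * |(j : ℝ) - i|) ^ 2 := by ring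
      _ ≤ _ := by gcongr
  have h5 : |(h * ((j : ℝ) - i) - (y - x)) * latSlope h (U k) i| ≤ h * K := by
    rw [abs_mul]
    gcongr
    exact hU.slope_le k i
  have h6 := abs_add_le (U k j - U k i - h * latSlope h (U k) i * (j - i))
    ((h * ((j : ℝ) - i) - (y - x)) * latSlope h (U k) i)
  calc _ = _ := by congr 1; ring
    _ ≤ _ := h6
    _ ≤ _ := by linarith

lemma taylor_flux (hU : LatticeSol A lam Lam h K F M N U) (hh : 0 < h) {k : ℕ} {x y ε : ℝ}
    (hε : ∀ l : ℤ, |h * (l - ⌊x / h⌋)| ≤ |y - x| + 2 * h →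
      |latFlux A h (U k) l - latFlux A h (U k) ⌊x / h⌋| ≤ ε) :
    |A (latSlope h (U k) ⌊y / h⌋) - A (latSlope h (U k) ⌊x / h⌋)
        - (y - x) * latFlux A h (U k) ⌊x / h⌋| ≤ ε * (|y - x| + h) + F * h := by
  have hF : 0 ≤ F := hU.flux_nonneg 0 0
  set i := ⌊x / h⌋
  set j := ⌊y / h⌋
  have h2 : h * |(j : ℝ) - i| ≤ |y - x| + h := floor_div_dist hh x y
  have h3 : |h * ((j : ℝ) - i) - (y - x)| ≤ h := floor_div_sub hh x y
  have hε0 : 0 ≤ ε := (abs_nonneg _).trans (hε i (by simp; positivity))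
  have h1 := int_increment_abs (g := fun l => A (latSlope h (U k) l))
    (a := h * latFlux A h (U k) i) (C := h * ε) (i := i) (j := j) fun l hl hl' => by
      rw [A_latSlope_sub hh, ← mul_sub, abs_mul, abs_of_pos hh]
      gcongr
      apply hε
      have : |((l + 1 : ℤ) : ℝ) - i| ≤ |(j : ℝ) - i| + 1 := by
        norm_cast
        rcases le_total i j with hij | hij
        · rw [abs_of_nonneg (by omega), abs_of_nonneg (by omega)]; omega
        · rw [abs_of_nonpos (by omega : j - i ≤ 0)]
          rw [abs_le]; omega
      rw [abs_mul, abs_of_pos hh]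
      nlinarith
  have h4 : h * ε * |(j : ℝ) - i| ≤ ε * (|y - x| + h) :=
    calc _ = ε * (h * |(j : ℝ) - i|) := by ring
      _ ≤ _ := by gcongr
  have h5 : |(h * ((j : ℝ) - i) - (y - x)) * latFlux A h (U k) i| ≤ h * F := by
    rw [abs_mul]
    gcongr
    exact hU.flux_le k i
  have h6 := abs_add_le (A (latSlope h (U k) j) - A (latSlope h (U k) i)
    - h * latFlux A h (U k) i * (j - i))
    ((h * ((j : ℝ) - i) - (y - x)) * latFlux A h (U k) i)
  calc _ = _ := by congr 1; ring
    _ ≤ _ := h6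
    _ ≤ _ := by linarith

lemma abs_sub_time (hU : LatticeSol A lam Lam h K F M N U)
    (hh : 0 < h) (hLam : 0 < Lam) (i : ℤ) (s t : ℝ) :
    |U ⌊t / (h ^ 2 / (4 * Lam))⌋₊ i - U ⌊s / (h ^ 2 / (4 * Lam))⌋₊ i|
      ≤ F * (|t - s| + h ^ 2 / (4 * Lam)) := by
  have hF : 0 ≤ F := hU.flux_nonneg 0 0
  have hτ : 0 < h ^ 2 / (4 * Lam) := by positivity
  have h1 := nat_increment_abs (g := fun k => U k i) (a := 0) (C := F * (h ^ 2 / (4 * Lam)))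
    (i := ⌊s / (h ^ 2 / (4 * Lam))⌋₊) (j := ⌊t / (h ^ 2 / (4 * Lam))⌋₊) fun l _ _ => by
      rw [hU.step, add_sub_cancel_left, sub_zero, abs_mul, abs_of_pos hτ, mul_comm]
      gcongr
      exact hU.flux_le l _
  have h2 := natFloor_div_dist hτ s t
  rw [zero_mul, sub_zero, mul_assoc] at h1
  exact h1.trans (by gcongr)

lemma taylor_time (hU : LatticeSol A lam Lam h K F M N U)
    (hh : 0 < h) (hLam : 0 < Lam) {i : ℤ} {s t ε : ℝ} (hs : 0 ≤ s) (ht : 0 ≤ t)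
    (hε : ∀ l : ℕ, (l : ℝ) * (h ^ 2 / (4 * Lam)) ≤ max s t →
      min s t ≤ l * (h ^ 2 / (4 * Lam)) + h ^ 2 / (4 * Lam) →
      |latFlux A h (U l) i - latFlux A h (U ⌊s / (h ^ 2 / (4 * Lam))⌋₊) i| ≤ ε) :
    |U ⌊t / (h ^ 2 / (4 * Lam))⌋₊ i - U ⌊s / (h ^ 2 / (4 * Lam))⌋₊ i
        - (t - s) * latFlux A h (U ⌊s / (h ^ 2 / (4 * Lam))⌋₊) i|
      ≤ ε * (|t - s| + h ^ 2 / (4 * Lam)) + F * (h ^ 2 / (4 * Lam)) := by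
  have hF : 0 ≤ F := hU.flux_nonneg 0 0
  have hτ : 0 < h ^ 2 / (4 * Lam) := by positivity
  have hstep := hU.step
  set τ := h ^ 2 / (4 * Lam)
  have hfl : ∀ r, 0 ≤ r → (⌊r / τ⌋₊ : ℝ) * τ ≤ r := fun r hr => by
    rw [← le_div_iff₀ hτ]; exact Nat.floor_le (by positivity)
  have hfl' : ∀ r, r ≤ (⌊r / τ⌋₊ : ℝ) * τ + τ := fun r => by
    rw [← add_one_mul, ← div_le_iff₀ hτ]; exact (Nat.lt_floor_add_one _).le
  have hs1 := hfl s hs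
  have hs2 := hfl' s
  have ht1 := hfl t ht
  have ht2 := hfl' t
  have h2 := natFloor_div_dist hτ s t
  have h3 := natFloor_div_sub hτ hs ht
  have hε0 : 0 ≤ ε := (abs_nonneg _).trans (hε ⌊s / τ⌋₊ (hs1.trans (le_max_left _ _))
    ((min_le_left _ _).trans hs2))
  set i' := ⌊s / τ⌋₊
  set j := ⌊t / τ⌋₊
  have h1 := nat_increment_abs (g := fun k => U k i) (a := τ * latFlux A h (U i') i)
    (C := τ * ε) (i := i') (j := j) fun l hl hl' => by
      rw [hstep, add_sub_cancel_left, ← mul_sub, abs_mul, abs_of_pos hτ]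
      gcongr
      apply hε
      · rcases lt_max_iff.1 hl' with h | h
        · exact (by gcongr : (l : ℝ) * τ ≤ i' * τ).trans (hs1.trans (le_max_left _ _))
        · exact (by gcongr : (l : ℝ) * τ ≤ j * τ).trans (ht1.trans (le_max_right _ _))
      · rcases min_le_iff.1 hl with h | h
        · exact (min_le_left _ _).trans (hs2.trans (by gcongr))
        · exact (min_le_right _ _).trans (ht2.trans (by gcongr))
  have h4 : τ * ε * |(j : ℝ) - i'| ≤ ε * (|t - s| + τ) :=
    calc _ = ε * (τ * |(j : ℝ) - i'|) := by ring
      _ ≤ _ := by gcongr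
  have h5 : |(τ * ((j : ℝ) - i') - (t - s)) * latFlux A h (U i') i| ≤ τ * F := by
    rw [abs_mul]
    gcongr
    exact hU.flux_le _ i
  have h6 := abs_add_le (U j i - U i' i - τ * latFlux A h (U i') i * (j - i'))
    ((τ * ((j : ℝ) - i') - (t - s)) * latFlux A h (U i') i)
  calc _ = _ := by congr 1; ring
    _ ≤ _ := h6
    _ ≤ _ := by linarith

end LatticeSol
end

section
variable {A : ℝ → ℝ} {lam Lam F : ℝ}

lemma LatticeSol.exists_flux_modulus (hlam : 0 < lam) (hlL : lam ≤ Lam) (hF : 0 ≤ F) {t₀ ε : ℝ}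
    (ht₀ : 0 < t₀) (hε : 0 < ε) :
    ∃ r > 0, ∃ h₀ > 0, ∀ {h K M : ℝ} {N : ℕ} {U : ℕ → ℤ → ℝ}, 0 < h → h ≤ h₀ →
      LatticeSol A lam Lam h K F M N U → ∀ (k k' : ℕ) (i i' : ℤ),
      t₀ ≤ k * (h ^ 2 / (4 * Lam)) + h ^ 2 / (4 * Lam) →
      t₀ ≤ k' * (h ^ 2 / (4 * Lam)) + h ^ 2 / (4 * Lam) →
      |(k : ℝ) - k'| * (h ^ 2 / (4 * Lam)) ≤ r → |(i : ℝ) - i'| * h ≤ r →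
      |latFlux A h (U k) i - latFlux A h (U k') i'| ≤ ε := by
  have hLam := hlam.trans_le hlL
  set ℓ := lam / (4 * Lam) with hℓdef
  have hℓ : 0 < ℓ := by positivity
  have hℓ4 : ℓ ≤ 1 / 4 := by
    rw [hℓdef, div_le_div_iff₀ (by positivity) (by norm_num)]; linarith
  have hδ : 0 < ℓ * rexp (-(496 / ℓ)) := by positivity
  have hδ1 : ℓ * rexp (-(496 / ℓ)) ≤ 1 := by
    have : rexp (-(496 / ℓ)) ≤ 1 := by rw [Real.exp_le_one_iff]; simp; positivity
    nlinarith
  obtain ⟨j, hj⟩ : ∃ j : ℕ, (1 - ℓ * rexp (-(496 / ℓ))) ^ j * (2 * F) ≤ ε := by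
    obtain ⟨j, hj⟩ := exists_pow_lt_of_lt_one (show 0 < ε / (2 * F + 1) by positivity)
      (show 1 - ℓ * rexp (-(496 / ℓ)) < 1 by linarith)
    refine ⟨j, ?_⟩
    rw [lt_div_iff₀ (by positivity)] at hj
    have : 0 ≤ (1 - ℓ * rexp (-(496 / ℓ))) ^ j := pow_nonneg (by linarith) j
    nlinarith
  obtain ⟨ρ, hρ, hρt⟩ : ∃ ρ > 0, ρ ^ 2 * 144 ^ j ≤ 2 * Lam * t₀ := by
    refine ⟨√(2 * Lam * t₀ / 144 ^ j), by positivity, ?_⟩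
    rw [sq_sqrt (by positivity)]
    field_simp
    rfl
  refine ⟨min (ρ / 2) (ρ ^ 2 / (16 * Lam)), by positivity, ρ * ℓ / 32, by positivity, ?_⟩
  intro h K M N U hh hh0 hU
  have hhρ : h ≤ ρ / 2 := by nlinarith
  set τ := h ^ 2 / (4 * Lam) with hτdef
  have hτ : 0 < τ := by positivity
  have hhτ : h ^ 2 = 4 * Lam * τ := by rw [hτdef]; field_simp
  have hτ0 : τ ≤ t₀ / 2 := by
    have h1 : (1 : ℝ) ≤ 144 ^ j := one_le_pow₀ (by norm_num)
    have h2 : ρ ^ 2 ≤ 2 * Lam * t₀ := by nlinarith [sq_nonneg ρ]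
    have h3 : h ^ 2 ≤ (ρ / 2) ^ 2 := by gcongr
    have h4 : 4 * Lam * τ ≤ 4 * Lam * (t₀ / 2) := by rw [← hhτ]; nlinarith [sq_nonneg ρ]
    exact le_of_mul_le_mul_left h4 (by positivity)
  set n := ⌊ρ / h⌋₊
  have hn1 : n * h ≤ ρ := by rw [← le_div_iff₀ hh]; exact Nat.floor_le (by positivity)
  have hn2 : ρ ≤ n * h + h := by
    rw [← add_one_mul, ← div_le_iff₀ hh]; exact (Nat.lt_floor_add_one _).le
  have hn16 : 16 ≤ ℓ * n := by
    have h1 : h * 16 ≤ h * (ℓ * n) := by nlinarith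
    exact le_of_mul_le_mul_left h1 hh
  have main : ∀ (k k' : ℕ) (i i' : ℤ), k ≤ k' → t₀ ≤ k' * τ + τ →
      |(k : ℝ) - k'| * τ ≤ min (ρ / 2) (ρ ^ 2 / (16 * Lam)) →
      |(i : ℝ) - i'| * h ≤ min (ρ / 2) (ρ ^ 2 / (16 * Lam)) →
      |latFlux A h (U k) i - latFlux A h (U k') i'| ≤ ε := by
    intro k k' i i' hkk hk' hk hi
    obtain ⟨c, hc, hlin⟩ := hU.lin
    have hkj : (12 ^ j * n) ^ 2 ≤ k' := by
      have h1 : ((12 ^ j * n : ℝ)) ^ 2 ≤ k' := by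
        have e : ((12 ^ j * n : ℝ)) ^ 2 = 144 ^ j * n ^ 2 := by
          rw [mul_pow, ← pow_mul, mul_comm j, pow_mul]; norm_num
        have h2 : (n * h) ^ 2 ≤ ρ ^ 2 := by gcongr
        have h3 : (4 * Lam * τ) * (144 ^ j * n ^ 2) ≤ (4 * Lam * τ) * k' := by
          calc (4 * Lam * τ) * (144 ^ j * (n : ℝ) ^ 2) = (n * h) ^ 2 * 144 ^ j := by
                rw [← hhτ]; ring
            _ ≤ ρ ^ 2 * 144 ^ j := by gcongr
            _ ≤ 2 * Lam * t₀ := hρt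
            _ ≤ 4 * Lam * (t₀ - τ) := by nlinarith
            _ ≤ 4 * Lam * (k' * τ) := by gcongr; linarith
            _ = _ := by ring
        rw [e]
        exact le_of_mul_le_mul_left h3 (by positivity)
      exact_mod_cast h1
    have hkn : k' ≤ k + n ^ 2 := by
      have h1 : ((k' : ℝ) - k) * τ ≤ ρ ^ 2 / (16 * Lam) := by
        rw [abs_sub_comm, abs_of_nonneg (by simpa using hkk)] at hk
        exact hk.trans (min_le_right _ _)
      have h2 : ρ / 2 ≤ n * h := by linarith
      have h3 : (ρ / 2) ^ 2 ≤ (n * h) ^ 2 := by gcongr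
      rw [le_div_iff₀ (by positivity)] at h1
      have h4 : (16 * Lam * τ) * ((k' : ℝ) - k) ≤ (16 * Lam * τ) * n ^ 2 := by
        rw [mul_pow, hhτ] at h3
        nlinarith
      have h5 := le_of_mul_le_mul_left h4 (by positivity)
      have : (k' : ℝ) ≤ k + n ^ 2 := by linarith
      exact_mod_cast this
    have hin : |i - i'| ≤ n := by
      have h1 : |(i : ℝ) - i'| * h ≤ n * h := by
        have := hi.trans (min_le_left _ _)
        linarith
      have h2 := le_of_mul_le_mul_right h1 hh
      exact_mod_cast h2
    obtain ⟨m', hm'⟩ := lattice_osc_decay (w := fun k i => A (latSlope h (U k) i) / h) (c := c)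
      (i₀ := i') (n := n) (kₑ := k') hℓ hℓ4 hn16 hc hlin j (m := -F) (O := 2 * F)
      (by positivity) hkj fun k i => by
        have := abs_le.1 (hU.flux_le k i)
        rw [latFlux_eq_sub] at this
        exact ⟨this.1, by linarith [this.2]⟩
    simp only [← latFlux_eq_sub] at hm'
    have h1 := hm' k i hkk hkn hin
    have h2 := hm' k' i' le_rfl (by omega) (by simp)
    rw [abs_le]
    constructor <;> linarith
  intro k k' i i' h1 h2 h3 h4
  rcases le_total k k' with hk | hk
  · exact main k k' i i' hk h2 h3 h4
  · rw [abs_sub_comm]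
    exact main k' k i' i hk h1 (by rwa [abs_sub_comm]) (by rwa [abs_sub_comm])

end

section
variable {A : ℝ → ℝ} {lam Lam h K F M : ℝ} {N : ℕ} {U : ℕ → ℤ → ℝ}

namespace LatticeSol

lemma slope_anti (hU : LatticeSol A lam Lam h K F M N U) (hA : SlopesIn A lam Lam)
    (hlam : 0 < lam) (hh : 0 < h) (k : ℕ) {i j : ℤ} (hi : 0 ≤ i) (hij : i ≤ j) (hj : j ≤ N) :
    latSlope h (U k) j ≤ latSlope h (U k) i := by
  apply hA.le_of_le hlam
  have := int_increment_le (g := fun l => A (latSlope h (U k) l)) (C := 0) hij fun l hl hl' => by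
    rw [A_latSlope_sub hh]
    exact mul_nonpos_of_nonneg_of_nonpos hh.le (hU.flux_nonpos k _ (by omega) (by omega))
  linarith

lemma abs_slope_le_interior (hU : LatticeSol A lam Lam h K F M N U) (hA : SlopesIn A lam Lam)
    (hlam : 0 < lam) (hh : 0 < h) {d : ℝ} (hd : 0 < d) (k : ℕ) {i : ℤ} (hi : d ≤ i * h)
    (hi' : d ≤ (N - 1 - i) * h) : |latSlope h (U k) i| ≤ M / d := by
  have i0 : 0 < i := by
    have : (0 : ℝ) < i := by by_contra! hc; nlinarith
    exact_mod_cast this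
  have iN : i < N - 1 := by
    have : (i : ℝ) < N - 1 := by by_contra! hc; nlinarith
    have : (i : ℝ) < ((N - 1 : ℤ) : ℝ) := by push_cast; linarith
    exact_mod_cast this
  have h1 := int_le_increment (g := U k) (C := h * latSlope h (U k) i) i0.le fun l hl hl' => by
    rw [sub_eq_latSlope hh]
    exact mul_le_mul_of_nonneg_left (hU.slope_anti hA hlam hh k hl hl'.le (by omega)) hh.le
  have h2 := int_increment_le (g := U k) (C := h * latSlope h (U k) i)
    (show i + 1 ≤ (N : ℤ) by omega) fun l hl hl' => by
      rw [sub_eq_latSlope hh]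
      exact mul_le_mul_of_nonneg_left (hU.slope_anti hA hlam hh k (by omega) (by omega)
        (by omega)) hh.le
  rw [hU.zero] at h1
  rw [hU.half_period] at h2
  have h3 := hU.le k i (by omega) (by omega)
  have h4 := hU.le k (i + 1) (by omega) (by omega)
  have hM : 0 ≤ M := (hU.nonneg k i (by omega) (by omega)).trans h3
  push_cast at h1 h2
  have h5 : 0 ≤ M / d := by positivity
  have h6 : M / d * d = M := by field_simp
  set v := latSlope h (U k) i
  rw [abs_le]
  constructor
  · by_contra! hc
    have h7 : ((N - 1 - i) * h) * v ≤ d * v :=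
      mul_le_mul_of_nonpos_right hi' (by linarith)
    nlinarith
  · by_contra! hc
    have h7 : d * v ≤ (i * h) * v := mul_le_mul_of_nonneg_right hi (by linarith)
    nlinarith

lemma time_drop (hU : LatticeSol A lam Lam h K F M N U) (hh : 0 < h) (hLam : 0 < Lam)
    {P C : ℝ} {i : ℤ} {n : ℕ} (hC : ∀ p, |p| ≤ P → |A p| ≤ C)
    (hP : ∀ (k : ℕ) (l : ℤ), i - 1 ≤ l → l ≤ i + n → |latSlope h (U k) l| ≤ P) (k k' : ℕ) :
    (n * h) * (U k i - U k' i) ≤ 2 * P * (n * h) * (n * h)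
      + |(k' : ℝ) - k| * (h ^ 2 / (4 * Lam)) * (2 * C) := by
  have hstep := hU.step
  have hτ : 0 < h ^ 2 / (4 * Lam) := by positivity
  set τ := h ^ 2 / (4 * Lam)
  have hP0 : 0 ≤ P := (abs_nonneg _).trans (hP 0 i (by omega) (by omega))
  set S : ℕ → ℝ := fun k => ∑ l ∈ Finset.range n, U k (i + l) with hS
  have h1 : |S k' - S k| ≤ τ / h * (2 * C) * |(k' : ℝ) - k| := by
    have := nat_increment_abs (g := S) (a := 0) (C := τ / h * (2 * C)) (i := k) (j := k')
      fun κ _ _ => by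
        have e : S (κ + 1) - S κ = τ / h *
            (A (latSlope h (U κ) (i + n - 1)) - A (latSlope h (U κ) (i - 1))) := by
          have h3 := Finset.sum_range_sub (fun l : ℕ => A (latSlope h (U κ) (i + l - 1))) n
          simp only [Nat.cast_zero, add_zero] at h3
          rw [← h3, hS, Finset.mul_sum, ← Finset.sum_sub_distrib]
          refine Finset.sum_congr rfl fun l _ => ?_
          rw [hstep, latFlux]
          push_cast
          rw [← add_assoc, add_sub_cancel_right]
          ring
        rw [e, sub_zero, abs_mul, abs_of_pos (by positivity)]
        gcongr
        have h4 := abs_le.1 (hC _ (hP κ (i + n - 1) (by omega) (by omega)))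
        have h5 := abs_le.1 (hC _ (hP κ (i - 1) (by omega) (by omega)))
        rw [abs_le]
        constructor <;> linarith
    simpa using this
  have h2 : ∀ k, |S k - n * U k i| ≤ n * (P * (n * h)) := by
    intro k
    have e : S k - n * U k i = ∑ l ∈ Finset.range n, (U k (i + l) - U k i) := by
      rw [Finset.sum_sub_distrib]; simp [hS]
    rw [e]
    refine (Finset.abs_sum_le_sum_abs _ _).trans ?_
    refine (Finset.sum_le_card_nsmul _ _ (P * (n * h)) fun l hl => ?_).trans (by simp)
    have hl' : l < n := Finset.mem_range.1 hl
    have := int_increment_abs (g := U k) (a := 0) (C := P * h) (i := i) (j := i + l)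
      fun m hm hm' => by
        rw [sub_eq_latSlope hh, sub_zero, abs_mul, abs_of_pos hh, mul_comm]
        gcongr
        exact hP k m (by omega) (by omega)
    simp only [zero_mul, sub_zero, Int.cast_add, Int.cast_natCast, add_sub_cancel_left,
      Nat.abs_cast] at this
    refine this.trans ?_
    rw [mul_assoc, mul_comm h]
    have : (l : ℝ) ≤ n := by exact_mod_cast hl'.le
    gcongr
  have h3 := abs_le.1 h1
  have h4 := abs_le.1 (h2 k)
  have h5 := abs_le.1 (h2 k')
  have h6 : n * (U k i - U k' i) ≤ 2 * (n * (P * (n * h))) + τ / h * (2 * C) * |(k' : ℝ) - k| := by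
    linarith
  calc _ = h * (n * (U k i - U k' i)) := by ring
    _ ≤ h * (2 * (n * (P * (n * h))) + τ / h * (2 * C) * |(k' : ℝ) - k|) := by gcongr
    _ = _ := by field_simp

lemma time_drop_real (hU : LatticeSol A lam Lam h K F M N U) (hA : SlopesIn A lam Lam)
    (hlam : 0 < lam) (hLam : 0 < Lam) (hh : 0 < h) {d r C x : ℝ} (hr : 0 < r) (hrd : r ≤ d / 2)
    (hhr : h ≤ r / 2)
    (hC : ∀ p, |p| ≤ M / d → |A p| ≤ C) (hx : 2 * d ≤ x) (hx' : x ≤ N * h - 2 * d) (s t : ℝ) :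
    U ⌊s / (h ^ 2 / (4 * Lam))⌋₊ ⌊x / h⌋ - U ⌊t / (h ^ 2 / (4 * Lam))⌋₊ ⌊x / h⌋ ≤
      2 * (M / d) * r + (|t - s| + h ^ 2 / (4 * Lam)) * (4 * C) / r := by
  have hτ : 0 < h ^ 2 / (4 * Lam) := by positivity
  have hn1 : ⌊r / h⌋₊ * h ≤ r := by rw [← le_div_iff₀ hh]; exact Nat.floor_le (by positivity)
  have hn2 : r ≤ ⌊r / h⌋₊ * h + h := by
    rw [← add_one_mul, ← div_le_iff₀ hh]; exact (Nat.lt_floor_add_one _).le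
  have hi1 : ⌊x / h⌋ * h ≤ x := by rw [← le_div_iff₀ hh]; exact Int.floor_le _
  have hi2 : x ≤ ⌊x / h⌋ * h + h := by
    rw [← add_one_mul, ← div_le_iff₀ hh]; exact (Int.lt_floor_add_one _).le
  set n := ⌊r / h⌋₊
  set i := ⌊x / h⌋
  have hP : ∀ (k : ℕ) (l : ℤ), i - 1 ≤ l → l ≤ i + n → |latSlope h (U k) l| ≤ M / d := by
    intro k l h1 h2
    have h1' : (i : ℝ) - 1 ≤ l := by exact_mod_cast h1
    have h2' : (l : ℝ) ≤ i + n := by exact_mod_cast h2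
    refine hU.abs_slope_le_interior hA hlam hh (by linarith) k ?_ ?_
    · nlinarith
    · nlinarith
  have hM : 0 ≤ M / d := (abs_nonneg _).trans (hP 0 i (by omega) (by omega))
  have hC0 : 0 ≤ C := (abs_nonneg _).trans (hC 0 (by simpa using hM))
  have h1 := hU.time_drop hh hLam hC hP ⌊s / (h ^ 2 / (4 * Lam))⌋₊ ⌊t / (h ^ 2 / (4 * Lam))⌋₊
  have h2 := natFloor_div_dist hτ s t
  rw [mul_comm] at h2
  set a := (n : ℝ) * h
  have ha : r / 2 ≤ a := by linarith
  have ha0 : 0 < a := by linarith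
  have h3 := h1.trans (add_le_add le_rfl (mul_le_mul_of_nonneg_right h2
    (by positivity : (0 : ℝ) ≤ 2 * C)))
  rw [mul_comm a, ← le_div_iff₀ ha0] at h3
  refine h3.trans ?_
  rw [add_div, mul_div_cancel_right₀ _ ha0.ne']
  have : (|t - s| + h ^ 2 / (4 * Lam)) * (2 * C) / a ≤
      (|t - s| + h ^ 2 / (4 * Lam)) * (2 * C) / (r / 2) := by gcongr
  have e : (|t - s| + h ^ 2 / (4 * Lam)) * (2 * C) / (r / 2) =
      (|t - s| + h ^ 2 / (4 * Lam)) * (4 * C) / r := by field_simp; norm_num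
  rw [← e]
  gcongr

lemma time_anti (hU : LatticeSol A lam Lam h K F M N U) (hLam : 0 < Lam) {i : ℤ}
    (hi : 0 ≤ i) (hi' : i ≤ N) : Antitone fun k => U k i := by
  refine antitone_nat_of_succ_le fun k => ?_
  rw [hU.step]
  have := mul_nonpos_of_nonneg_of_nonpos (show 0 ≤ h ^ 2 / (4 * Lam) by positivity)
    (hU.flux_nonpos k i hi hi')
  linarith

end LatticeSol
end

lemma hasDerivAt_of_abs_le {g : ℝ → ℝ} {g' x : ℝ}
    (hg : ∀ ε > 0, ∃ r > 0, ∀ y, |y - x| ≤ r → |g y - g x - (y - x) * g'| ≤ ε * |y - x|) :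
    HasDerivAt g g' x := by
  rw [hasDerivAt_iff_isLittleO, Asymptotics.isLittleO_iff]
  intro ε hε
  obtain ⟨r, hr, h⟩ := hg ε hε
  filter_upwards [Metric.closedBall_mem_nhds x hr] with y hy
  rw [Metric.mem_closedBall, Real.dist_eq] at hy
  simpa using h y hy

lemma hasDerivAt_of_hasDerivAt_comp {A v : ℝ → ℝ} {x A' f : ℝ} (hA : HasDerivAt A A' (v x))
    (hA' : A' ≠ 0) (hv : ContinuousAt v x) (hw : HasDerivAt (fun y => A (v y)) f x) :
    HasDerivAt v (f / A') x := by
  rw [hasDerivAt_iff_tendsto_slope] at hw ⊢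
  have h1 : ContinuousAt (dslope A (v x)) (v x) := continuousAt_dslope_same.2 hA.differentiableAt
  have h2 : Tendsto (fun y => dslope A (v x) (v y)) (𝓝[≠] x) (𝓝 A') := by
    have := (ContinuousAt.comp (f := v) h1 hv).tendsto
    rw [Function.comp_apply, dslope_same, hA.deriv] at this
    exact this.mono_left nhdsWithin_le_nhds
  refine (hw.div h2 hA').congr' ?_
  filter_upwards [h2.eventually_ne hA'] with y hy
  rw [Pi.div_apply, div_eq_iff hy, slope_def_field, slope_def_field, div_mul_eq_mul_div]
  congr 1
  rw [← sub_smul_dslope, smul_eq_mul]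

lemma Ultrafilter.exists_tendsto_of_abs_le {ι : Type*} (𝓕 : Ultrafilter ι) {g : ι → ℝ} {C : ℝ}
    (hg : ∀ᶠ n in (𝓕 : Filter ι), |g n| ≤ C) : ∃ l, Tendsto g 𝓕 (𝓝 l) := by
  obtain ⟨l, -, hl⟩ := (isCompact_Icc (a := -C) (b := C)).ultrafilter_le_nhds (𝓕.map g) (by
    rw [le_principal_iff]
    exact hg.mono fun n hn => abs_le.1 hn)
  exact ⟨l, hl⟩

/-- A function `u` with spatial derivative `v` and time derivative `f` solving
`∂ₜ u = ∂ₓ (A (∂ₓ u))`, `A' = a`, odd, `L`-periodic, concave on a half period, with initial values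
between `P - δ` and `P`, together with quantitative interior bounds. -/
structure ParabolicSol (A a : ℝ → ℝ) (K M L δ : ℝ) (P : ℝ → ℝ) (u v f : ℝ → ℝ → ℝ) : Prop where
  hasDerivAt_x : ∀ x t, HasDerivAt (fun y => u y t) (v x t) x
  hasDerivAt_xx : ∀ x t, 0 < t → HasDerivAt (fun y => v y t) (f x t / a (v x t)) x
  hasDerivAt_t : ∀ x t, 0 < t → HasDerivAt (fun s => u x s) (f x t) t
  continuous_u : Continuous fun p : ℝ × ℝ => u p.1 p.2
  continuous_v : Continuous fun p : ℝ × ℝ => v p.1 p.2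
  continuousOn_f : ContinuousOn (fun p : ℝ × ℝ => f p.1 p.2) (univ ×ˢ Ioi 0)
  abs_v_le : ∀ x t, |v x t| ≤ K
  per : ∀ x t, u (x + L) t = u x t
  odd : ∀ x t, u (-x) t = -u x t
  anti_v : ∀ t, AntitoneOn (fun x => v x t) (Icc 0 (L / 2))
  nonneg : ∀ x ∈ Icc 0 (L / 2), ∀ t, 0 ≤ u x t
  le : ∀ x ∈ Icc 0 (L / 2), ∀ t, u x t ≤ M
  time_anti : ∀ x ∈ Icc 0 (L / 2), Antitone fun t => u x t
  abs_v_le_interior : ∀ x t d, 0 < d → 2 * d ≤ x → x ≤ L / 2 - 2 * d → |v x t| ≤ M / d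
  time_drop : ∀ x s t d r C, 0 < r → r ≤ d / 2 → (∀ p, |p| ≤ M / d → |A p| ≤ C) → 2 * d ≤ x →
    x ≤ L / 2 - 2 * d → u x s - u x t ≤ 2 * (M / d) * r + |t - s| * (4 * C) / r
  init : ∀ x ∈ Icc 0 (L / 2), P x - δ ≤ u x 0 ∧ u x 0 ≤ P x

section
variable {A a : ℝ → ℝ} {lam Lam K B F M L δ : ℝ} {P : ℝ → ℝ}

theorem exists_parabolicSol (hlam : 0 < lam) (hlL : lam ≤ Lam) (hA : SlopesIn A lam Lam)
    (ha : ∀ p, HasDerivAt A (a p) p) (ha0 : ∀ p, a p ≠ 0) (hL : 0 < L) (hP : Continuous P)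
    (hG : ∀ᶠ N : ℕ in atTop, ∃ G : ℤ → ℝ, LatticeData (L / (2 * N)) K B M N G ∧
      ∀ i : ℤ, 0 ≤ i → i ≤ N → P (i * (L / (2 * N))) - δ ≤ G i ∧ G i ≤ P (i * (L / (2 * N)))) :
    ∃ u v f, ParabolicSol A a K M L δ P u v f := by
  have hLam : 0 < Lam := hlam.trans_le hlL
  obtain ⟨G, hG⟩ := hG.choice
  set F := Lam * B with hFdef
  set h : ℕ → ℝ := fun N => L / (2 * N) with hh
  set τ : ℕ → ℝ := fun N => h N ^ 2 / (4 * Lam) with hτ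
  set U : ℕ → ℕ → ℤ → ℝ := fun N => latEvolve A Lam (h N) (G N) with hU
  set 𝓕 := hyperfilter ℕ with h𝓕
  have hle : (𝓕 : Filter ℕ) ≤ atTop := Nat.hyperfilter_le_atTop
  have hh0 : Tendsto h 𝓕 (𝓝 0) := by
    refine Tendsto.mono_left ?_ hle
    refine Tendsto.div_atTop tendsto_const_nhds ?_
    exact Tendsto.const_mul_atTop two_pos tendsto_natCast_atTop_atTop
  have hτ0 : Tendsto τ 𝓕 (𝓝 0) := by
    have := (hh0.pow 2).div_const (4 * Lam)
    simpa using this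
  have hS : ∀ᶠ N in (𝓕 : Filter ℕ), 0 < h N ∧ 0 < τ N ∧ N * h N = L / 2 ∧
      LatticeSol A lam Lam (h N) K F M N (U N) ∧ ∀ i : ℤ, 0 ≤ i → i ≤ N →
        P (i * h N) - δ ≤ G N i ∧ G N i ≤ P (i * h N) := by
    filter_upwards [hle hG, hle (eventually_gt_atTop 0)] with N h1 hN
    have hN' : (0 : ℝ) < N := by exact_mod_cast hN
    have : 0 < h N := by simp only [hh]; positivity
    refine ⟨this, by simp only [hτ]; positivity, ?_, h1.1.latticeSol hA hlam hLam this, h1.2⟩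
    simp only [hh]; field_simp
  obtain ⟨N₀, -, -, -, hN₀, -⟩ := hS.exists
  have hF : 0 ≤ F := hN₀.flux_nonneg 0 0
  have hK : 0 ≤ K := (abs_nonneg _).trans (hN₀.slope_le 0 0)
  clear hN₀ N₀
  set Uh : ℕ → ℝ → ℝ → ℝ := fun N x t => U N ⌊t / τ N⌋₊ ⌊x / h N⌋ with hUh
  set Vh : ℕ → ℝ → ℝ → ℝ := fun N x t => latSlope (h N) (U N ⌊t / τ N⌋₊) ⌊x / h N⌋ with hVh
  set Fh : ℕ → ℝ → ℝ → ℝ := fun N x t => latFlux A (h N) (U N ⌊t / τ N⌋₊) ⌊x / h N⌋ with hFh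
  have exu : ∀ x t, ∃ l, Tendsto (fun N => Uh N x t) 𝓕 (𝓝 l) := fun x t => by
    refine 𝓕.exists_tendsto_of_abs_le (C := K * (|x| + 1)) ?_
    filter_upwards [hS, hh0.eventually (gt_mem_nhds one_pos)] with N hN h1
    have := hN.2.2.2.1.abs_sub_space hN.1 ⌊t / τ N⌋₊ 0 x
    rw [zero_div, Int.floor_zero, hN.2.2.2.1.zero, sub_zero, sub_zero] at this
    exact this.trans (by gcongr)
  have exv : ∀ x t, ∃ l, Tendsto (fun N => Vh N x t) 𝓕 (𝓝 l) := fun x t =>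
    𝓕.exists_tendsto_of_abs_le (C := K) (hS.mono fun N hN => hN.2.2.2.1.slope_le _ _)
  have exf : ∀ x t, ∃ l, Tendsto (fun N => Fh N x t) 𝓕 (𝓝 l) := fun x t =>
    𝓕.exists_tendsto_of_abs_le (C := F) (hS.mono fun N hN => hN.2.2.2.1.flux_le _ _)
  choose u hu using exu
  choose v hv using exv
  choose f hf using exf
  have hAc : Continuous A := continuous_iff_continuousAt.2 fun p => (ha p).continuousAt
  have u_x : ∀ x y t, |u y t - u x t| ≤ K * |y - x| := fun x y t => by
    have l1 := ((hu y t).sub (hu x t)).abs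
    have l2 : Tendsto (fun N => K * (|y - x| + h N)) 𝓕 (𝓝 (K * (|y - x| + 0))) :=
      (tendsto_const_nhds.add hh0).const_mul K
    rw [add_zero] at l2
    exact le_of_tendsto_of_tendsto l1 l2
      (hS.mono fun N hN => hN.2.2.2.1.abs_sub_space hN.1 _ x y)
  have u_t : ∀ x s t, |u x t - u x s| ≤ F * |t - s| := fun x s t => by
    have l1 := ((hu x t).sub (hu x s)).abs
    have l2 : Tendsto (fun N => F * (|t - s| + τ N)) 𝓕 (𝓝 (F * (|t - s| + 0))) :=
      (tendsto_const_nhds.add hτ0).const_mul F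
    rw [add_zero] at l2
    exact le_of_tendsto_of_tendsto l1 l2
      (hS.mono fun N hN => hN.2.2.2.1.abs_sub_time hN.1 hLam _ s t)
  have v_x : ∀ x y t, |v y t - v x t| ≤ F / lam * |y - x| := fun x y t => by
    have l1 := ((hv y t).sub (hv x t)).abs
    have l2 : Tendsto (fun N => F / lam * (|y - x| + h N)) 𝓕 (𝓝 (F / lam * (|y - x| + 0))) :=
      (tendsto_const_nhds.add hh0).const_mul _
    rw [add_zero] at l2
    exact le_of_tendsto_of_tendsto l1 l2
      (hS.mono fun N hN => hN.2.2.2.1.abs_slope_sub hA hlam hN.1 _ x y)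
  have u_taylor : ∀ x y t, |u y t - u x t - (y - x) * v x t| ≤ F / lam * |y - x| ^ 2 :=
    fun x y t => by
      have l1 := (((hu y t).sub (hu x t)).sub ((hv x t).const_mul (y - x))).abs
      have l2 : Tendsto (fun N => F / lam * (|y - x| + h N) ^ 2 + K * h N) 𝓕
          (𝓝 (F / lam * (|y - x| + 0) ^ 2 + K * 0)) :=
        (((tendsto_const_nhds.add hh0).pow 2).const_mul _).add (hh0.const_mul _)
      rw [add_zero, mul_zero, add_zero] at l2
      exact le_of_tendsto_of_tendsto l1 l2
        (hS.mono fun N hN => hN.2.2.2.1.taylor_space hA hlam hN.1 _ x y)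
  have modulus : ∀ t₀ > 0, ∀ ε > 0, ∃ r > 0, ∀ x y s t, t₀ ≤ s → t₀ ≤ t → |y - x| ≤ r →
      |t - s| ≤ r → |f y t - f x s| ≤ ε ∧
        |A (v y s) - A (v x s) - (y - x) * f x s| ≤ ε * |y - x| ∧
        |u x t - u x s - (t - s) * f x s| ≤ ε * |t - s| := by
    intro t₀ ht₀ ε hε
    obtain ⟨r, hr, h₀, hh₀, H⟩ := LatticeSol.exists_flux_modulus (A := A) hlam hlL hF ht₀ hε
    have small : ∀ᶠ N in (𝓕 : Filter ℕ), h N ≤ h₀ ∧ h N ≤ r / 4 ∧ τ N ≤ r / 4 := by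
      filter_upwards [hh0.eventually (gt_mem_nhds hh₀),
        hh0.eventually (gt_mem_nhds (show 0 < r / 4 by positivity)),
        hτ0.eventually (gt_mem_nhds (show 0 < r / 4 by positivity))] with N h1 h2 h3
      exact ⟨h1.le, h2.le, h3.le⟩
    have floor_bounds : ∀ {τ t : ℝ}, 0 < τ → 0 ≤ t →
        (⌊t / τ⌋₊ : ℝ) * τ ≤ t ∧ t ≤ (⌊t / τ⌋₊ : ℝ) * τ + τ := fun {τ t} hτ ht =>
      ⟨by rw [← le_div_iff₀ hτ]; exact Nat.floor_le (by positivity),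
        by rw [← add_one_mul, ← div_le_iff₀ hτ]; exact (Nat.lt_floor_add_one _).le⟩
    refine ⟨r / 2, by positivity, fun x y s t hs ht hxy hst => ⟨?_, ?_, ?_⟩⟩
    · refine le_of_tendsto ((hf y t).sub (hf x s)).abs ?_
      filter_upwards [hS, small] with N hN hN'
      obtain ⟨p1, p2, p3, p4, -⟩ := hN
      refine H p1 hN'.1 p4 _ _ _ _ (ht.trans (floor_bounds p2 (ht₀.le.trans ht)).2)
        (hs.trans (floor_bounds p2 (ht₀.le.trans hs)).2) ?_ ?_
      · have := natFloor_div_dist p2 s t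
        rw [mul_comm]
        linarith
      · have := floor_div_dist p1 x y
        rw [mul_comm]
        linarith
    · have l1 := ((((hAc.tendsto _).comp (hv y s)).sub ((hAc.tendsto _).comp (hv x s))).sub
        ((hf x s).const_mul (y - x))).abs
      have l2 : Tendsto (fun N => ε * (|y - x| + h N) + F * h N) 𝓕
          (𝓝 (ε * (|y - x| + 0) + F * 0)) :=
        ((tendsto_const_nhds.add hh0).const_mul _).add (hh0.const_mul _)
      rw [add_zero, mul_zero, add_zero] at l2
      refine le_of_tendsto_of_tendsto l1 l2 ?_
      filter_upwards [hS, small] with N hN hN'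
      obtain ⟨p1, p2, p3, p4, -⟩ := hN
      refine p4.taylor_flux p1 fun l hl => ?_
      have hk := hs.trans (floor_bounds p2 (ht₀.le.trans hs)).2
      refine H p1 hN'.1 p4 _ _ _ _ hk hk (by simpa using hr.le) ?_
      rw [abs_mul, abs_of_pos p1, mul_comm] at hl
      linarith
    · have l1 := (((hu x t).sub (hu x s)).sub ((hf x s).const_mul (t - s))).abs
      have l2 : Tendsto (fun N => ε * (|t - s| + τ N) + F * τ N) 𝓕
          (𝓝 (ε * (|t - s| + 0) + F * 0)) :=
        ((tendsto_const_nhds.add hτ0).const_mul _).add (hτ0.const_mul _)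
      rw [add_zero, mul_zero, add_zero] at l2
      refine le_of_tendsto_of_tendsto l1 l2 ?_
      filter_upwards [hS, small] with N hN hN'
      obtain ⟨p1, p2, p3, p4, -⟩ := hN
      refine p4.taylor_time p1 hLam (ht₀.le.trans hs) (ht₀.le.trans ht) fun l hl hl' => ?_
      obtain ⟨q1, q2⟩ := floor_bounds p2 (ht₀.le.trans hs)
      refine H p1 hN'.1 p4 _ _ _ _ ((le_min hs ht).trans hl') (hs.trans q2) ?_
        (by simpa using hr.le)
      change |(l : ℝ) - ⌊s / τ N⌋₊| * τ N ≤ r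
      rw [← abs_of_pos p2, ← abs_mul, abs_of_pos p2, abs_le]
      have e1 := le_abs_self (t - s)
      have e2 := neg_abs_le (t - s)
      have e3 : max s t ≤ s + |t - s| :=
        max_le (by linarith [abs_nonneg (t - s)]) (by linarith)
      have e4 : s - |t - s| ≤ min s t :=
        le_min (by linarith [abs_nonneg (t - s)]) (by linarith)
      rw [sub_mul]
      change (l : ℝ) * τ N ≤ _ at hl
      change _ ≤ (l : ℝ) * τ N + τ N at hl'
      constructor <;> linarith
  have v_t : ∀ x s t e, 0 < e → |v x t - v x s| ≤ 2 * F / e * |t - s| + 2 * (F / lam) * e := by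
    intro x s t e he
    have h1 := abs_le.1 (u_taylor x (x + e) t)
    have h2 := abs_le.1 (u_taylor x (x + e) s)
    have h3 := abs_le.1 (u_t x s t)
    have h4 := abs_le.1 (u_t (x + e) s t)
    rw [add_sub_cancel_left, abs_of_pos he] at h1 h2
    have key : |e * (v x t - v x s)| ≤ e * (2 * F / e * |t - s| + 2 * (F / lam) * e) := by
      have : e * (2 * F / e * |t - s| + 2 * (F / lam) * e) =
        2 * (F * |t - s|) + 2 * (F / lam * e ^ 2) := by field_simp
      rw [this, abs_le]
      constructor <;> linarith
    rw [abs_mul, abs_of_pos he] at key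
    exact le_of_mul_le_mul_left key he
  have cont_u : Continuous fun p : ℝ × ℝ => u p.1 p.2 := by
    rw [continuous_iff_continuousAt]
    rintro ⟨x, s⟩
    rw [ContinuousAt, tendsto_iff_dist_tendsto_zero]
    have l2 : Tendsto (fun p : ℝ × ℝ => K * |p.1 - x| + F * |p.2 - s|) (𝓝 (x, s))
        (𝓝 (K * |x - x| + F * |s - s|)) :=
      Continuous.tendsto (f := fun p : ℝ × ℝ => K * |p.1 - x| + F * |p.2 - s|)
        (by fun_prop) (x, s)
    simp only [sub_self, abs_zero, mul_zero, add_zero] at l2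
    refine squeeze_zero (fun _ => dist_nonneg) (fun p => ?_) l2
    have := abs_add_le (u p.1 p.2 - u x p.2) (u x p.2 - u x s)
    rw [sub_add_sub_cancel] at this
    exact this.trans (add_le_add (u_x _ _ _) (u_t _ _ _))
  have cont_v : Continuous fun p : ℝ × ℝ => v p.1 p.2 := by
    rw [continuous_iff_continuousAt]
    rintro ⟨x, s⟩
    rw [Metric.continuousAt_iff']
    intro ε hε
    obtain ⟨e, he, hee⟩ : ∃ e > 0, 2 * (F / lam) * e < ε / 2 := by
      refine ⟨ε / (4 * (F / lam) + 4), by positivity, ?_⟩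
      rw [mul_div_assoc', div_lt_div_iff₀ (by positivity) (by positivity)]
      nlinarith [show 0 ≤ F / lam by positivity]
    have l2 : Tendsto (fun p : ℝ × ℝ => F / lam * |p.1 - x| + 2 * F / e * |p.2 - s|) (𝓝 (x, s))
        (𝓝 (F / lam * |x - x| + 2 * F / e * |s - s|)) :=
      Continuous.tendsto (f := fun p : ℝ × ℝ => F / lam * |p.1 - x| + 2 * F / e * |p.2 - s|)
        (by fun_prop) (x, s)
    simp only [sub_self, abs_zero, mul_zero, add_zero] at l2
    filter_upwards [l2.eventually (gt_mem_nhds (show 0 < ε / 2 by positivity))] with p hp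
    have := abs_add_le (v p.1 p.2 - v x p.2) (v x p.2 - v x s)
    rw [sub_add_sub_cancel] at this
    have h1 := v_x x p.1 p.2
    have h2 := v_t x s p.2 e he
    rw [Real.dist_eq]
    linarith
  have cont_f : ContinuousOn (fun p : ℝ × ℝ => f p.1 p.2) (univ ×ˢ Ioi 0) := by
    refine continuousOn_of_forall_continuousAt ?_
    rintro ⟨x, s⟩ ⟨-, hs⟩
    rw [mem_Ioi] at hs
    dsimp only at hs
    rw [Metric.continuousAt_iff']
    intro ε hε
    obtain ⟨r, hr, H⟩ := modulus (s / 2) (by positivity) (ε / 2) (by positivity)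
    have : ∀ᶠ p : ℝ × ℝ in 𝓝 (x, s), dist p (x, s) < min r (s / 2) :=
      Metric.ball_mem_nhds _ (by positivity)
    filter_upwards [this] with p hp
    rw [Prod.dist_eq, max_lt_iff, Real.dist_eq, Real.dist_eq, lt_min_iff, lt_min_iff] at hp
    have := (H x p.1 s p.2 (by linarith) (by linarith [(abs_lt.1 hp.2.2).1]) hp.1.1.le
      hp.2.1.le).1
    rw [Real.dist_eq]
    linarith
  have der_x : ∀ x t, HasDerivAt (fun y => u y t) (v x t) x := by
    intro x t
    refine hasDerivAt_of_abs_le fun ε hε => ⟨ε / (F / lam + 1), by positivity, fun y hy => ?_⟩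
    refine (u_taylor x y t).trans ?_
    rw [le_div_iff₀ (by positivity)] at hy
    rw [pow_two, ← mul_assoc]
    refine mul_le_mul_of_nonneg_right ?_ (abs_nonneg _)
    linarith [abs_nonneg (y - x)]
  have index : ∀ {h x : ℝ} {N : ℕ}, 0 < h → N * h = L / 2 → x ∈ Icc 0 (L / 2) →
      0 ≤ ⌊x / h⌋ ∧ ⌊x / h⌋ ≤ N := by
    intro h x N hh hN hx
    refine ⟨Int.floor_nonneg.2 (div_nonneg hx.1 hh.le), Int.floor_le_iff.2 ?_⟩
    rw [div_lt_iff₀ hh]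
    push_cast
    linarith [hx.2]
  refine ⟨u, v, f, der_x, ?_, ?_, cont_u, cont_v, cont_f, ?_, ?_, ?_, ?_, ?_, ?_, ?_, ?_, ?_, ?_⟩
  · intro x t ht
    refine hasDerivAt_of_hasDerivAt_comp (ha _) (ha0 _)
      (cont_v.comp (by fun_prop : Continuous fun y : ℝ => (y, t))).continuousAt ?_
    refine hasDerivAt_of_abs_le fun ε hε => ?_
    obtain ⟨r, hr, H⟩ := modulus t ht ε hε
    exact ⟨r, hr, fun y hy => (H x y t t le_rfl le_rfl hy (by simpa using hr.le)).2.1⟩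
  · intro x t ht
    refine hasDerivAt_of_abs_le fun ε hε => ?_
    obtain ⟨r, hr, H⟩ := modulus (t / 2) (by positivity) ε hε
    refine ⟨min r (t / 2), by positivity, fun s hs => ?_⟩
    rw [le_min_iff] at hs
    exact (H x x t s (by linarith) (by linarith [(abs_le.1 hs.2).1]) (by simpa using hr.le)
      hs.1).2.2
  · exact fun x t => le_of_tendsto (hv x t).abs (hS.mono fun N hN => hN.2.2.2.1.slope_le _ _)
  · intro x t
    refine tendsto_nhds_unique ((hu (x + L) t).congr' ?_) (hu x t)
    filter_upwards [hS] with N hN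
    simp only [hUh]
    rw [← hN.2.2.2.1.per _ ⌊x / h N⌋]
    congr 1
    have : (x + L) / h N = x / h N + ((2 * N : ℤ) : ℝ) := by
      have := hN.1
      have h3 := hN.2.2.1
      push_cast
      field_simp
      linarith
    rw [this, Int.floor_add_intCast]
  · intro x t
    rw [← sub_eq_zero, sub_neg_eq_add, ← abs_eq_zero]
    refine le_antisymm ?_ (abs_nonneg _)
    have l2 : Tendsto (fun N => K * (2 * h N)) 𝓕 (𝓝 (K * (2 * 0))) :=
      (hh0.const_mul 2).const_mul K
    rw [mul_zero, mul_zero] at l2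
    refine le_of_tendsto_of_tendsto ((hu (-x) t).add (hu x t)).abs l2 ?_
    filter_upwards [hS] with N hN
    have h1 := hN.2.2.2.1.abs_sub_space hN.1 ⌊t / τ N⌋₊ (((-⌊x / h N⌋ : ℤ) : ℝ) * h N) (-x)
    rw [mul_div_cancel_right₀ _ hN.1.ne', Int.floor_intCast, hN.2.2.2.1.odd, sub_neg_eq_add] at h1
    refine h1.trans ?_
    gcongr
    have h2 : ⌊x / h N⌋ * h N ≤ x := by rw [← le_div_iff₀ hN.1]; exact Int.floor_le _
    have h3 : x ≤ ⌊x / h N⌋ * h N + h N := by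
      rw [← add_one_mul, ← div_le_iff₀ hN.1]; exact (Int.lt_floor_add_one _).le
    have : |-x - ((-⌊x / h N⌋ : ℤ) : ℝ) * h N| ≤ h N := by
      push_cast
      rw [abs_le]; constructor <;> linarith
    linarith
  · refine fun t x hx y hy hxy => le_of_tendsto_of_tendsto (hv y t) (hv x t) ?_
    filter_upwards [hS] with N hN
    refine hN.2.2.2.1.slope_anti hA hlam hN.1 _ (index hN.1 hN.2.2.1 hx).1
      (Int.floor_mono ?_) (index hN.1 hN.2.2.1 hy).2
    have := hN.1
    gcongr
  · refine fun x hx t => ge_of_tendsto (hu x t) (hS.mono fun N hN => ?_)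
    exact hN.2.2.2.1.nonneg _ _ (index hN.1 hN.2.2.1 hx).1 (index hN.1 hN.2.2.1 hx).2
  · refine fun x hx t => le_of_tendsto (hu x t) (hS.mono fun N hN => ?_)
    exact hN.2.2.2.1.le _ _ (index hN.1 hN.2.2.1 hx).1 (index hN.1 hN.2.2.1 hx).2
  · refine fun x hx s t hst => le_of_tendsto_of_tendsto (hu x t) (hu x s) ?_
    filter_upwards [hS] with N hN
    refine hN.2.2.2.1.time_anti hLam (index hN.1 hN.2.2.1 hx).1 (index hN.1 hN.2.2.1 hx).2
      (Nat.floor_mono ?_)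
    have := hN.2.1
    gcongr
  · intro x t d hd hx hx'
    refine le_of_tendsto (hv x t).abs ?_
    filter_upwards [hS, hh0.eventually (gt_mem_nhds (show 0 < d by positivity))] with N hN hN'
    have h2 : ⌊x / h N⌋ * h N ≤ x := by rw [← le_div_iff₀ hN.1]; exact Int.floor_le _
    have h3 : x ≤ ⌊x / h N⌋ * h N + h N := by
      rw [← add_one_mul, ← div_le_iff₀ hN.1]; exact (Int.lt_floor_add_one _).le
    have h4 := hN.2.2.1
    refine hN.2.2.2.1.abs_slope_le_interior hA hlam hN.1 hd _ (by linarith) ?_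
    rw [sub_mul, sub_mul]
    linarith
  · intro x s t d r C hr hrd hC hx hx'
    have l2 : Tendsto (fun N => 2 * (M / d) * r + (|t - s| + τ N) * (4 * C) / r) 𝓕
        (𝓝 (2 * (M / d) * r + (|t - s| + 0) * (4 * C) / r)) :=
      (((tendsto_const_nhds.add hτ0).mul_const _).div_const _).const_add _
    rw [add_zero] at l2
    refine le_of_tendsto_of_tendsto ((hu x s).sub (hu x t)) l2 ?_
    filter_upwards [hS, hh0.eventually (gt_mem_nhds (show 0 < r / 2 by positivity))] with N hN hN'
    exact hN.2.2.2.1.time_drop_real hA hlam hLam hN.1 hr hrd hN'.le hC hx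
      (by rw [hN.2.2.1]; exact hx') s t
  · intro x hx
    have hx0 : Tendsto (fun N => ⌊x / h N⌋ * h N) 𝓕 (𝓝 x) := by
      have l2 := (tendsto_const_nhds (x := x)).sub hh0
      rw [sub_zero] at l2
      refine tendsto_of_tendsto_of_tendsto_of_le_of_le' l2 tendsto_const_nhds ?_ ?_
      · filter_upwards [hS] with N hN
        have : x ≤ ⌊x / h N⌋ * h N + h N := by
          rw [← add_one_mul, ← div_le_iff₀ hN.1]; exact (Int.lt_floor_add_one _).le
        linarith
      · filter_upwards [hS] with N hN
        rw [← le_div_iff₀ hN.1]; exact Int.floor_le _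
    have hPx := (hP.tendsto x).comp hx0
    have e : ∀ N, Uh N x 0 = G N ⌊x / h N⌋ := fun N => by
      simp only [hUh, zero_div, Nat.floor_zero]
      rfl
    constructor
    · refine le_of_tendsto_of_tendsto (hPx.sub_const δ) (hu x 0) ?_
      filter_upwards [hS] with N hN
      rw [e]
      exact (hN.2.2.2.2 _ (index hN.1 hN.2.2.1 hx).1 (index hN.1 hN.2.2.1 hx).2).1
    · refine le_of_tendsto_of_tendsto (hu x 0) hPx ?_
      filter_upwards [hS] with N hN
      rw [e]
      exact (hN.2.2.2.2 _ (index hN.1 hN.2.2.1 hx).1 (index hN.1 hN.2.2.1 hx).2).2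
end

/-- A uniformly elliptic replacement of `α` outside `[-K, K]`, together with its primitive. -/
lemma exists_truncated_primitive {α : ℝ → ℝ} (hα : Continuous α) (hαpos : ∀ p, 0 < α p) {K : ℝ}
    (hK : 0 ≤ K) :
    ∃ (A a : ℝ → ℝ) (lam Lam : ℝ), 0 < lam ∧ lam ≤ Lam ∧ SlopesIn A lam Lam ∧
      (∀ p, HasDerivAt A (a p) p) ∧ (∀ p, a p ≠ 0) ∧ (∀ p, |p| ≤ K → a p = α p) ∧
      ∀ P C, (∀ q, |q| ≤ P → α q ≤ C) → ∀ p, |p| ≤ P → |A p| ≤ P * C := by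
  set a : ℝ → ℝ := fun p => α (max (-K) (min p K)) with hadef
  have hac : Continuous a := by fun_prop
  have hclamp : ∀ p, max (-K) (min p K) ∈ Icc (-K) K := fun p =>
    ⟨le_max_left _ _, max_le (by linarith) (min_le_right _ _)⟩
  have hapos : ∀ p, 0 < a p := fun p => hαpos _
  obtain ⟨p₁, -, h₁⟩ := (isCompact_Icc (a := -K) (b := K)).exists_isMinOn
    ⟨0, by simpa using hK⟩ hα.continuousOn
  obtain ⟨p₂, -, h₂⟩ := (isCompact_Icc (a := -K) (b := K)).exists_isMaxOn
    ⟨0, by simpa using hK⟩ hα.continuousOn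
  have hlo : ∀ p, α p₁ ≤ a p := fun p => h₁ (hclamp p)
  have hup : ∀ p, a p ≤ α p₂ := fun p => h₂ (hclamp p)
  have hder : ∀ p, HasDerivAt (fun p => ∫ x in (0 : ℝ)..p, a x) (a p) p := fun p =>
    (hac.integral_hasStrictDerivAt 0 p).hasDerivAt
  set A : ℝ → ℝ := fun p => ∫ x in (0 : ℝ)..p, a x with hA
  have hAc : Continuous A := continuous_iff_continuousAt.2 fun p => (hder p).continuousAt
  have mvt : ∀ p q, ∃ c ∈ uIcc p q, A p - A q = a c * (p - q) := by
    intro p q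
    wlog hpq : q < p generalizing p q
    · rcases (not_lt.1 hpq).eq_or_lt with rfl | h
      · exact ⟨p, left_mem_uIcc, by simp⟩
      · obtain ⟨c, hc, e⟩ := this q p h
        exact ⟨c, by rwa [uIcc_comm], by linarith⟩
    obtain ⟨c, hc, e⟩ := exists_hasDerivAt_eq_slope A a hpq hAc.continuousOn fun x _ => hder x
    refine ⟨c, by rw [uIcc_of_ge hpq.le]; exact ⟨hc.1.le, hc.2.le⟩, ?_⟩
    rw [e]
    have : p - q ≠ 0 := (sub_pos.2 hpq).ne'
    field_simp
  refine ⟨A, a, α p₁, α p₂, hαpos _, (hlo 0).trans (hup 0), ?_, hder, fun p => (hapos p).ne',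
    ?_, ?_⟩
  · intro p q
    obtain ⟨c, -, e⟩ := mvt p q
    exact ⟨a c, hlo c, hup c, e⟩
  · intro p hp
    have := abs_le.1 hp
    simp only [hadef]
    rw [min_eq_left this.2, max_eq_right this.1]
  · intro P C hC p hp
    obtain ⟨c, hc, e⟩ := mvt p 0
    have hA0 : A 0 = 0 := by simp [hA]
    have hcP : |c| ≤ |p| := by
      rw [uIcc_comm] at hc
      simpa using abs_sub_left_of_mem_uIcc hc
    have hclampc : |max (-K) (min c K)| ≤ |c| := by
      rw [abs_le]
      constructor
      · exact le_max_of_le_right (le_min (neg_abs_le c) (by linarith [abs_nonneg c]))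
      · exact max_le (by linarith [abs_nonneg c]) ((min_le_left _ _).trans (le_abs_self c))
    rw [hA0, sub_zero, sub_zero] at e
    rw [e, abs_mul, abs_of_pos (hapos c), mul_comm]
    have h1 : a c ≤ C := hC _ ((hclampc.trans hcP).trans hp)
    exact mul_le_mul hp h1 (hapos c).le ((abs_nonneg p).trans hp)

section
variable {ψ : ℝ → ℝ} {H : ℝ}

lemma ConcaveOn.mul_le_mul_of_pos_Ioo (hψ : ConcaveOn ℝ (Ioo 0 H) ψ)
    (hpos : ∀ z ∈ Ioo 0 H, 0 < ψ z) {x y : ℝ} (hx : 0 < x) (hxy : x ≤ y) (hy : y < H) :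
    ψ y * x ≤ ψ x * y := by
  rcases hxy.eq_or_lt with rfl | hxy
  · exact le_rfl
  have key : ∀ e ∈ Ioo 0 x, ψ y * (x - e) ≤ ψ x * (y - e) := by
    intro e he
    have hye : 0 < y - e := by linarith [he.2]
    have hyx : 0 ≤ (y - x) / (y - e) := div_nonneg (by linarith) hye.le
    have hxe : 0 ≤ (x - e) / (y - e) := div_nonneg (by linarith [he.2]) hye.le
    have hmem : e ∈ Ioo 0 H := ⟨he.1, he.2.trans (hxy.trans hy)⟩
    have hmem' : y ∈ Ioo 0 H := ⟨hx.trans hxy, hy⟩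
    have h := hψ.2 hmem hmem' hyx hxe (by
      rw [← add_div, div_eq_one_iff_eq hye.ne']; ring)
    have e1 : (y - x) / (y - e) * e + (x - e) / (y - e) * y = x := by field_simp; ring
    simp only [smul_eq_mul] at h
    rw [e1] at h
    have h2 : 0 ≤ (y - x) / (y - e) * ψ e :=
      mul_nonneg hyx (hpos e hmem).le
    have h3 : (x - e) / (y - e) * ψ y ≤ ψ x := by linarith
    rw [div_mul_eq_mul_div, div_le_iff₀ hye] at h3
    linarith
  have hcont : ContinuousWithinAt (fun e => ψ x * (y - e) - ψ y * (x - e)) (Ioo 0 x) 0 := by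
    fun_prop
  have : 0 ∈ closure (Ioo 0 x) := by rw [closure_Ioo hx.ne]; exact ⟨le_rfl, hx.le⟩
  have hmem := hcont.mem_closure this (t := Ici 0) fun e he => sub_nonneg.2 (key e he)
  rw [closure_Ici, mem_Ici] at hmem
  simp only [sub_zero] at hmem
  linarith

lemma ConcaveOn.comp_const_sub (hψ : ConcaveOn ℝ (Ioo 0 H) ψ) :
    ConcaveOn ℝ (Ioo 0 H) fun x => ψ (H - x) := by
  refine ⟨convex_Ioo _ _, fun x hx y hy a b ha hb hab => ?_⟩
  have hx' : H - x ∈ Ioo 0 H := ⟨by linarith [hx.2], by linarith [hx.1]⟩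
  have hy' : H - y ∈ Ioo 0 H := ⟨by linarith [hy.2], by linarith [hy.1]⟩
  have := hψ.2 hx' hy' ha hb hab
  simp only [smul_eq_mul] at this ⊢
  convert this using 2
  linear_combination (-hab) * H

lemma ConcaveOn.sub_le_of_pos_Ioo (hψ : ConcaveOn ℝ (Ioo 0 H) ψ)
    (hpos : ∀ z ∈ Ioo 0 H, 0 < ψ z) {c x y : ℝ} (hc : 0 < c) (hcx : c ≤ x) (hxy : x ≤ y)
    (hy : y < H) : ψ y - ψ x ≤ ψ c / c * (y - x) := by
  have h1 := hψ.mul_le_mul_of_pos_Ioo hpos (hc.trans_le hcx) hxy hy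
  have h2 := hψ.mul_le_mul_of_pos_Ioo hpos hc hcx (hxy.trans_lt hy)
  have hx := hc.trans_le hcx
  have h3 : ψ x / x ≤ ψ c / c := by rw [div_le_div_iff₀ hx hc]; linarith
  have h4 : ψ y - ψ x ≤ ψ x / x * (y - x) := by
    rw [div_mul_eq_mul_div, le_div_iff₀ hx]; linarith
  exact h4.trans (mul_le_mul_of_nonneg_right h3 (by linarith))

/-- Replacing a positive concave function on `(0, H)` by chords near the end points. -/
lemma exists_concave_cap (hψ : ConcaveOn ℝ (Ioo 0 H) ψ) (hpos : ∀ z ∈ Ioo 0 H, 0 < ψ z) {c : ℝ}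
    (hc : 0 < c) (hcH : c ≤ H / 2) :
    ∃ (P : ℝ → ℝ) (K k₁ k₂ : ℝ), 0 < K ∧ (∀ x y, |P x - P y| ≤ K * |x - y|) ∧
      (∀ x s, P (x + s) + P (x - s) ≤ 2 * P x) ∧ (∀ x ∈ Icc c (H - c), P x = ψ x) ∧
      (∀ x ∈ Ioo 0 H, P x ≤ ψ x) ∧ (∀ x ∈ Icc 0 H, 0 ≤ P x) ∧ (∀ x ≤ c, P x = k₁ * x) ∧
      ∀ x, H - c ≤ x → P x = k₂ * (H - x) := by
  have hcc : c ≤ H - c := by linarith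
  have hpos' : ∀ z ∈ Ioo 0 H, 0 < ψ (H - z) := fun z hz =>
    hpos _ ⟨by linarith [hz.2], by linarith [hz.1]⟩
  set k₁ := ψ c / c with hk₁
  set k₂ := ψ (H - c) / c with hk₂
  have k₁pos : 0 < k₁ := div_pos (hpos c ⟨hc, by linarith⟩) hc
  have k₂pos : 0 < k₂ := div_pos (hpos _ ⟨by linarith, by linarith⟩) hc
  have up : ∀ x y, c ≤ x → x ≤ y → y ≤ H - c → ψ y - ψ x ≤ k₁ * (y - x) := fun x y h1 h2 h3 =>
    hψ.sub_le_of_pos_Ioo hpos hc h1 h2 (by linarith)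
  have dn : ∀ x y, c ≤ x → x ≤ y → y ≤ H - c → ψ x - ψ y ≤ k₂ * (y - x) := fun x y h1 h2 h3 => by
    have := hψ.comp_const_sub.sub_le_of_pos_Ioo hpos' hc (x := H - y) (y := H - x)
      (by linarith) (by linarith) (by linarith)
    simp only [sub_sub_cancel] at this
    rwa [sub_sub_sub_cancel_left] at this
  set Q : ℝ → ℝ → ℝ := fun y x => ψ y - k₁ * max (y - x) 0 - k₂ * max (x - y) 0 with hQ
  set cl : ℝ → ℝ := fun x => max c (min x (H - c)) with hcl
  have hclmem : ∀ x, cl x ∈ Icc c (H - c) := fun x =>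
    ⟨le_max_left _ _, max_le hcc (min_le_right _ _)⟩
  have cl_mid : ∀ x ∈ Icc c (H - c), cl x = x := fun x hx => by
    simp only [hcl]; rw [min_eq_left hx.2, max_eq_right hx.1]
  have cl_left : ∀ x ≤ c, cl x = c := fun x hx => max_eq_left ((min_le_left _ _).trans hx)
  have cl_right : ∀ x, H - c ≤ x → cl x = H - c := fun x hx => by
    simp only [hcl]; rw [min_eq_right hx, max_eq_right hcc]
  have P_mid : ∀ x ∈ Icc c (H - c), Q (cl x) x = ψ x := fun x hx => by simp [hQ, cl_mid x hx]
  have P_left : ∀ x ≤ c, Q (cl x) x = k₁ * x := fun x hx => by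
    simp only [hQ, cl_left x hx]
    rw [max_eq_left (by linarith), max_eq_right (by linarith)]
    have : ψ c = k₁ * c := by rw [hk₁]; field_simp
    rw [this]; ring
  have P_right : ∀ x, H - c ≤ x → Q (cl x) x = k₂ * (H - x) := fun x hx => by
    simp only [hQ, cl_right x hx]
    rw [max_eq_right (by linarith), max_eq_left (by linarith)]
    have : ψ (H - c) = k₂ * c := by rw [hk₂]; field_simp
    rw [this]; ring
  have sup : ∀ x, ∀ y ∈ Icc c (H - c), Q y x ≤ Q (cl x) x := by
    intro x y hy
    rcases le_total x c with hx | hx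
    · have := up c y le_rfl hy.1 hy.2
      simp only [hQ, cl_left x hx]
      rw [max_eq_left (by linarith [hy.1]), max_eq_right (by linarith [hy.1]),
        max_eq_left (by linarith), max_eq_right (by linarith)]
      linarith
    rcases le_total x (H - c) with hx' | hx'
    · rw [P_mid x ⟨hx, hx'⟩]
      simp only [hQ]
      rcases le_total x y with hxy | hxy
      · rw [max_eq_left (by linarith), max_eq_right (by linarith)]
        linarith [up x y hx hxy hy.2]
      · rw [max_eq_right (by linarith), max_eq_left (by linarith)]
        linarith [dn y x hy.1 hxy hx']
    · have := dn y (H - c) hy.1 hy.2 le_rfl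
      simp only [hQ, cl_right x hx']
      rw [max_eq_right (by linarith [hy.2]), max_eq_left (by linarith [hy.2]),
        max_eq_right (by linarith), max_eq_left (by linarith)]
      linarith
  have lip : ∀ x y, Q (cl x) x - Q (cl y) y ≤ max k₁ k₂ * |x - y| := by
    intro x y
    have h1 := sup y (cl x) (hclmem x)
    have h2 : Q (cl x) x - Q (cl x) y ≤ max k₁ k₂ * |x - y| := by
      simp only [hQ]
      generalize cl x = z
      have hm1 := le_max_left k₁ k₂
      have hm2 := le_max_right k₁ k₂
      rcases le_total x y with hxy | hxy
      · rw [abs_of_nonpos (by linarith)]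
        have a1 : max (z - y) 0 ≤ max (z - x) 0 := by gcongr
        have a2 : max (y - z) 0 ≤ max (x - z) 0 + (y - x) := by
          refine max_le ?_ ?_
          · linarith [le_max_left (x - z) 0]
          · linarith [le_max_right (x - z) 0]
        nlinarith
      · rw [abs_of_nonneg (by linarith)]
        have a1 : max (x - z) 0 ≥ max (y - z) 0 := by gcongr
        have a2 : max (z - y) 0 ≤ max (z - x) 0 + (x - y) := by
          refine max_le ?_ ?_
          · linarith [le_max_left (z - x) 0]
          · linarith [le_max_right (z - x) 0]
        nlinarith
    linarith
  refine ⟨fun x => Q (cl x) x, max k₁ k₂, k₁, k₂, lt_max_of_lt_left k₁pos, ?_, ?_, P_mid, ?_, ?_,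
    P_left, P_right⟩
  · intro x y
    rw [abs_le]
    have := lip y x
    rw [abs_sub_comm] at this
    exact ⟨by linarith, lip x y⟩
  · intro x s
    set y₁ := cl (x + s)
    set y₂ := cl (x - s)
    have m₁ : y₁ ∈ Icc c (H - c) := hclmem _
    have m₂ : y₂ ∈ Icc c (H - c) := hclmem _
    have h1 := sup x ((y₁ + y₂) / 2) ⟨by linarith [m₁.1, m₂.1], by linarith [m₁.2, m₂.2]⟩
    have o₁ : y₁ ∈ Ioo 0 H := ⟨by linarith [m₁.1], by linarith [m₁.2]⟩
    have o₂ : y₂ ∈ Ioo 0 H := ⟨by linarith [m₂.1], by linarith [m₂.2]⟩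
    have half : (0 : ℝ) ≤ 1 / 2 := by norm_num
    have h2 := hψ.2 o₁ o₂ half half (by norm_num)
    simp only [smul_eq_mul] at h2
    rw [show 1 / 2 * y₁ + 1 / 2 * y₂ = (y₁ + y₂) / 2 by ring] at h2
    have a1 : 2 * max ((y₁ + y₂) / 2 - x) 0 ≤ max (y₁ - (x + s)) 0 + max (y₂ - (x - s)) 0 := by
      have b1 := le_max_left (y₁ - (x + s)) 0
      have b2 := le_max_right (y₁ - (x + s)) 0
      have b3 := le_max_left (y₂ - (x - s)) 0
      have b4 := le_max_right (y₂ - (x - s)) 0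
      rcases max_choice ((y₁ + y₂) / 2 - x) 0 with h | h <;> rw [h] <;> linarith
    have a2 : 2 * max (x - (y₁ + y₂) / 2) 0 ≤ max (x + s - y₁) 0 + max (x - s - y₂) 0 := by
      have b1 := le_max_left (x + s - y₁) 0
      have b2 := le_max_right (x + s - y₁) 0
      have b3 := le_max_left (x - s - y₂) 0
      have b4 := le_max_right (x - s - y₂) 0
      rcases max_choice (x - (y₁ + y₂) / 2) 0 with h | h <;> rw [h] <;> linarith
    have a3 := mul_le_mul_of_nonneg_left a1 k₁pos.le
    have a4 := mul_le_mul_of_nonneg_left a2 k₂pos.le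
    simp only [hQ] at h1 ⊢
    linarith
  · intro x hx
    dsimp only
    rcases le_total x c with h | h
    · rw [P_left x h]
      have := hψ.mul_le_mul_of_pos_Ioo hpos hx.1 h (by linarith)
      rw [hk₁, div_mul_eq_mul_div, div_le_iff₀ hc]
      exact this
    rcases le_total x (H - c) with h' | h'
    · rw [P_mid x ⟨h, h'⟩]
    · rw [P_right x h']
      have := hψ.comp_const_sub.mul_le_mul_of_pos_Ioo hpos' (x := H - x) (y := c)
        (by linarith [hx.2]) (by linarith) (by linarith)
      rw [sub_sub_cancel] at this
      rw [hk₂, div_mul_eq_mul_div, div_le_iff₀ hc]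
      exact this
  · intro x hx
    dsimp only
    rcases le_total x c with h | h
    · rw [P_left x h]; exact mul_nonneg k₁pos.le hx.1
    rcases le_total x (H - c) with h' | h'
    · rw [P_mid x ⟨h, h'⟩]; exact (hpos x ⟨by linarith, by linarith⟩).le
    · rw [P_right x h']; exact mul_nonneg k₂pos.le (by linarith [hx.2])

end

/-- The average of `Q` over the window of radius `m` around `i`. -/
noncomputable def windowAverage (m : ℕ) (Q : ℤ → ℝ) (i : ℤ) : ℝ :=
  (∑ l ∈ Finset.range (2 * m + 1), Q (i + (l - m))) / (2 * m + 1)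

section
variable {m : ℕ} {Q : ℤ → ℝ}

lemma two_mul_sum_window (m : ℕ) (Q : ℤ → ℝ) (i : ℤ) :
    2 * ∑ l ∈ Finset.range (2 * m + 1), Q (i + (l - m)) =
      ∑ l ∈ Finset.range (2 * m + 1), (Q (i + (l - m)) + Q (i - (l - m))) := by
  rw [Finset.sum_add_distrib, two_mul]
  congr 1
  rw [← Finset.sum_range_reflect]
  refine Finset.sum_congr rfl fun l hl => ?_
  have := Finset.mem_range.1 hl
  congr 1
  omega

lemma windowAverage_le (hQ : ∀ i j, Q (i + j) + Q (i - j) ≤ 2 * Q i) (i : ℤ) :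
    windowAverage m Q i ≤ Q i := by
  have h1 := two_mul_sum_window m Q i
  have h2 : ∑ l ∈ Finset.range (2 * m + 1), (Q (i + (l - m)) + Q (i - (l - m))) ≤
      ∑ _l ∈ Finset.range (2 * m + 1), 2 * Q i := Finset.sum_le_sum fun l _ => hQ i _
  rw [Finset.sum_const, Finset.card_range, nsmul_eq_mul] at h2
  push_cast at h2
  rw [windowAverage, div_le_iff₀ (by positivity)]
  linarith

lemma windowAverage_eq_of_linear {i : ℤ} {v : ℝ}
    (h : ∀ j : ℤ, |j| ≤ m → Q (i + j) + Q (i - j) = 2 * v) : windowAverage m Q i = v := by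
  have h1 := two_mul_sum_window m Q i
  have h2 : ∑ l ∈ Finset.range (2 * m + 1), (Q (i + (l - m)) + Q (i - (l - m))) =
      ∑ _l ∈ Finset.range (2 * m + 1), 2 * v := Finset.sum_congr rfl fun l hl => h _ <| by
    have := Finset.mem_range.1 hl
    rw [abs_le]; omega
  rw [Finset.sum_const, Finset.card_range, nsmul_eq_mul] at h2
  push_cast at h2
  rw [windowAverage, div_eq_iff (by positivity)]
  linarith

lemma le_windowAverage {D : ℝ} (hD : 0 ≤ D) (hQ : ∀ i j, |Q i - Q j| ≤ D * |(i : ℝ) - j|) (i : ℤ) :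
    Q i - D * m ≤ windowAverage m Q i := by
  have h2 : ∑ _l ∈ Finset.range (2 * m + 1), (Q i - D * m) ≤
      ∑ l ∈ Finset.range (2 * m + 1), Q (i + (l - m)) := Finset.sum_le_sum fun l hl => by
    have hl := Finset.mem_range.1 hl
    have h1 := hQ i (i + (l - m))
    have h3 : |(i : ℝ) - ((i + (l - m) : ℤ) : ℝ)| ≤ m := by
      have : |i - (i + ((l : ℤ) - m))| ≤ (m : ℤ) := by rw [abs_le]; omega
      exact_mod_cast this
    have h4 := mul_le_mul_of_nonneg_left h3 hD
    have := le_abs_self (Q i - Q (i + (l - m)))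
    linarith
  rw [Finset.sum_const, Finset.card_range, nsmul_eq_mul] at h2
  push_cast at h2
  rw [windowAverage, le_div_iff₀ (by positivity)]
  linarith

lemma windowAverage_add_one_sub (i : ℤ) :
    windowAverage m Q (i + 1) - windowAverage m Q i =
      (Q (i + 1 + m) - Q (i - m)) / (2 * m + 1) := by
  rw [windowAverage, windowAverage, ← sub_div, ← Finset.sum_sub_distrib]
  congr 1
  have := Finset.sum_range_sub (fun l : ℕ => Q (i + (l - m))) (2 * m + 1)
  rw [show Q (i + 1 + m) - Q (i - m) = Q (i + ((2 * m + 1 : ℕ) - m)) - Q (i + ((0 : ℕ) - m)) by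
    congr 2 <;> push_cast <;> ring, ← this]
  refine Finset.sum_congr rfl fun l _ => ?_
  congr 2
  push_cast; ring

lemma abs_windowAverage_sub_le {D : ℝ} (hQ : ∀ i j, |Q i - Q j| ≤ D * |(i : ℝ) - j|) (i : ℤ) :
    |windowAverage m Q (i + 1) - windowAverage m Q i| ≤ D := by
  rw [windowAverage_add_one_sub, abs_div, abs_of_pos (by positivity : (0 : ℝ) < 2 * m + 1),
    div_le_iff₀ (by positivity)]
  refine (hQ _ _).trans_eq ?_
  congr 1
  push_cast
  rw [abs_of_nonneg] <;> [ring; (ring_nf; positivity)]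

lemma windowAverage_second_diff (i : ℤ) :
    windowAverage m Q (i + 1) - 2 * windowAverage m Q i + windowAverage m Q (i - 1) =
      ((Q (i + m + 1) - Q (i + m)) - (Q (i - 1 - m + 1) - Q (i - 1 - m))) / (2 * m + 1) := by
  have h1 := windowAverage_add_one_sub (m := m) (Q := Q) i
  have h2 := windowAverage_add_one_sub (m := m) (Q := Q) (i - 1)
  rw [sub_add_cancel] at h2
  have e1 : i - 1 - m + 1 = i - m := by ring
  have e2 : i + m + 1 = i + 1 + m := by ring
  rw [e1, e2]
  have : ∀ a b c d n : ℝ, ((a - b) - (c - d)) / n = (a - c) / n - (b - d) / n := by intros; ring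
  rw [this, ← h1, ← h2]; ring

lemma abs_windowAverage_second_diff_le {D : ℝ} (hQ : ∀ i j, |Q i - Q j| ≤ D * |(i : ℝ) - j|)
    (i : ℤ) :
    |windowAverage m Q (i + 1) - 2 * windowAverage m Q i + windowAverage m Q (i - 1)| ≤
      2 * D / (2 * m + 1) := by
  rw [windowAverage_second_diff, abs_div, abs_of_pos (by positivity : (0 : ℝ) < 2 * m + 1)]
  gcongr
  have key : ∀ j : ℤ, |Q (j + 1) - Q j| ≤ D := fun j => by
    have := hQ (j + 1) j
    push_cast at this
    simpa using this
  calc _ ≤ _ := abs_sub _ _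
    _ ≤ D + D := add_le_add (key _) (key _)
    _ = 2 * D := by ring

lemma windowAverage_second_diff_nonpos (hQ : ∀ i j, Q (i + j) + Q (i - j) ≤ 2 * Q i) (i : ℤ) :
    windowAverage m Q (i + 1) - 2 * windowAverage m Q i + windowAverage m Q (i - 1) ≤ 0 := by
  rw [windowAverage_second_diff]
  refine div_nonpos_of_nonpos_of_nonneg ?_ (by positivity)
  have := int_increment_le (g := fun j => Q (j + 1) - Q j) (a := i - 1 - m) (b := i + m) (C := 0)
    (by omega) fun l _ _ => by
      have := hQ (l + 1) 1
      rw [add_sub_cancel_right] at this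
      linarith
  simp only [zero_mul] at this
  exact this

end

lemma nonneg_of_second_diff_nonpos {G : ℤ → ℝ} {N : ℤ}
    (hG : ∀ i, G (i + 1) - 2 * G i + G (i - 1) ≤ 0) (h0 : G 0 = 0) (hN : G N = 0) {i : ℤ}
    (hi : 0 ≤ i) (hiN : i ≤ N) : 0 ≤ G i := by
  have anti : ∀ a b : ℤ, a ≤ b → G (b + 1) - G b ≤ G (a + 1) - G a := fun a b hab => by
    have := int_increment_le (g := fun j => G (j + 1) - G j) hab (C := 0) fun l _ _ => by
      have := hG (l + 1)
      rw [add_sub_cancel_right] at this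
      linarith
    simp only [zero_mul] at this
    linarith
  have h1 := int_le_increment (g := G) hi (C := G (i + 1) - G i) fun l _ hl => anti _ _ hl.le
  have h2 := int_increment_le (g := G) hiN (C := G (i + 1) - G i) fun l hl _ => anti _ _ hl
  have hi' : (0 : ℝ) ≤ i := by exact_mod_cast hi
  have hiN' : (i : ℝ) ≤ N := by exact_mod_cast hiN
  rw [h0] at h1
  rw [hN] at h2
  push_cast at h1
  rcases le_total 0 (G (i + 1) - G i) with h | h
  · nlinarith
  · nlinarith

/-- The odd `2 N`-periodic extension of a function on `{0, …, N}`. -/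
noncomputable def oddExtension (N : ℕ) (G : ℤ → ℝ) (i : ℤ) : ℝ :=
  if i % (2 * N) ≤ N then G (i % (2 * N)) else -G (2 * N - i % (2 * N))

section
variable {N : ℕ} {G : ℤ → ℝ}

lemma oddExtension_add (i : ℤ) : oddExtension N G (i + 2 * N) = oddExtension N G i := by
  simp [oddExtension]

lemma oddExtension_add_mul (i q : ℤ) :
    oddExtension N G (i + 2 * N * q) = oddExtension N G i := by
  simp [oddExtension]

lemma oddExtension_eq (hN : 2 ≤ N) (h1 : G (-1) = -G 1) (h2 : G (N + 1) = -G (N - 1)) {i : ℤ}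
    (hi : -1 ≤ i) (hiN : i ≤ N + 1) : oddExtension N G i = G i := by
  rcases hi.eq_or_lt with rfl | hi
  · rw [← oddExtension_add, oddExtension, Int.emod_eq_of_lt (by omega) (by omega),
      if_neg (by omega), h1]
    congr 2; ring
  rw [oddExtension, Int.emod_eq_of_lt (by omega) (by omega)]
  split_ifs with h
  · rfl
  · have : i = N + 1 := by omega
    rw [this, h2]
    congr 2; ring

lemma oddExtension_neg (hN : 2 ≤ N) (h0 : G 0 = 0) (hG : G N = 0) (i : ℤ) :
    oddExtension N G (-i) = -oddExtension N G i := by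
  have hr := Int.emod_nonneg i (b := 2 * N) (by omega)
  have hr' := Int.emod_lt_of_pos i (b := 2 * N) (by omega)
  have e : i = i % (2 * N) + 2 * N * (i / (2 * N)) := (Int.emod_add_mul_ediv _ _).symm
  generalize i % (2 * N) = r at *
  generalize i / (2 * N) = q at *
  have e' : -i = -r + 2 * N * (-q) := by rw [e]; ring
  rw [e', e, oddExtension_add_mul, oddExtension_add_mul]
  rcases hr.eq_or_lt with rfl | hr
  · simp [oddExtension, h0]
  rw [← oddExtension_add, oddExtension, oddExtension, Int.emod_eq_of_lt (by omega) (by omega),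
    Int.emod_eq_of_lt (by omega) (by omega)]
  split_ifs with h3 h4 h4
  · have : r = N := by omega
    subst this
    rw [show -(N : ℤ) + 2 * N = N by ring, hG, neg_zero]
  · rw [neg_neg]; congr 1; ring
  · congr 2; ring
  · omega

lemma oddExtension_eq_neg (hN : 2 ≤ N) (h0 : G 0 = 0) (hG : G N = 0) (h1 : G (-1) = -G 1)
    (h2 : G (N + 1) = -G (N - 1)) {i : ℤ} (hi : N - 1 ≤ i) (hiN : i ≤ 2 * N + 1) :
    oddExtension N G i = -G (2 * N - i) := by
  rw [← oddExtension_eq hN h1 h2 (i := 2 * N - i) (by omega) (by omega),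
    ← oddExtension_neg hN h0 hG, ← oddExtension_add (-(2 * N - i))]
  congr 1; ring

lemma latticeData_oddExtension {h K B M : ℝ} (hN : 2 ≤ N) (h0 : G 0 = 0) (hG : G N = 0)
    (h1 : G (-1) = -G 1) (h2 : G (N + 1) = -G (N - 1)) (hlip : ∀ i, |G (i + 1) - G i| ≤ K * h)
    (hsec : ∀ i, |G (i + 1) - 2 * G i + G (i - 1)| ≤ B * h ^ 2)
    (hconc : ∀ i, G (i + 1) - 2 * G i + G (i - 1) ≤ 0)
    (hM : ∀ i : ℤ, 0 ≤ i → i ≤ N → G i ≤ M) :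
    LatticeData h K B M N (oddExtension N G) := by
  have A : ∀ i : ℤ, -1 ≤ i → i ≤ N + 1 → oddExtension N G i = G i := fun i =>
    oddExtension_eq hN h1 h2
  have A' : ∀ i : ℤ, N - 1 ≤ i → i ≤ 2 * N + 1 → oddExtension N G i = -G (2 * N - i) := fun i =>
    oddExtension_eq_neg hN h0 hG h1 h2
  have red : ∀ p : ℤ → Prop, (∀ r q : ℤ, 0 ≤ r → r < 2 * N → p (r + 2 * N * q)) → ∀ i, p i := by
    intro p hp i
    rw [← Int.emod_add_mul_ediv i (2 * N)]
    exact hp _ _ (Int.emod_nonneg i (by omega)) (Int.emod_lt_of_pos i (by omega))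
  refine ⟨oddExtension_neg hN h0 hG, oddExtension_add, red _ ?_, red _ ?_, ?_, ?_, ?_⟩
  · intro r q hr hr'
    rw [add_right_comm, oddExtension_add_mul, oddExtension_add_mul]
    rcases lt_or_ge r N with h | h
    · rw [A _ (by omega) (by omega), A _ (by omega) (by omega)]
      exact hlip r
    · rw [A' _ (by omega) (by omega), A' _ (by omega) (by omega)]
      have := hlip (2 * N - (r + 1))
      rw [show 2 * (N : ℤ) - (r + 1) + 1 = 2 * N - r by ring] at this
      rwa [neg_sub_neg]
  · intro r q hr hr'
    rw [add_right_comm, add_sub_right_comm, oddExtension_add_mul, oddExtension_add_mul,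
      oddExtension_add_mul]
    rcases le_or_gt r N with h | h
    · rw [A _ (by omega) (by omega), A _ (by omega) (by omega), A _ (by omega) (by omega)]
      exact hsec r
    · rw [A' _ (by omega) (by omega), A' _ (by omega) (by omega), A' _ (by omega) (by omega)]
      have := hsec (2 * N - r)
      rw [← abs_neg] at this
      convert this using 2
      rw [show 2 * (N : ℤ) - (r + 1) = 2 * N - r - 1 by ring,
        show 2 * (N : ℤ) - (r - 1) = 2 * N - r + 1 by ring]
      ring
  · intro i hi hiN
    rw [A _ (by omega) (by omega), A _ (by omega) (by omega), A _ (by omega) (by omega)]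
    exact hconc i
  · intro i hi hiN
    rw [A _ (by omega) (by omega)]
    exact nonneg_of_second_diff_nonpos hconc h0 hG hi hiN
  · intro i hi hiN
    rw [A _ (by omega) (by omega)]
    exact hM i hi hiN

end

/-- A Lipschitz concave profile which is linear near both end points of `[0, L / 2]` is
approximated by lattice data with uniformly bounded second differences. -/
lemma eventually_exists_latticeData {P : ℝ → ℝ} {K M L c η k₁ k₂ : ℝ} (hL : 0 < L) (hK : 0 ≤ K)
    (hη : 0 < η) (hηc : 2 * η ≤ c) (hlip : ∀ x y, |P x - P y| ≤ K * |x - y|)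
    (hconc : ∀ x s, P (x + s) + P (x - s) ≤ 2 * P x) (hM : ∀ x ∈ Icc 0 (L / 2), P x ≤ M)
    (h₁ : ∀ x ≤ c, P x = k₁ * x) (h₂ : ∀ x, L / 2 - c ≤ x → P x = k₂ * (L / 2 - x)) :
    ∀ᶠ N : ℕ in atTop, ∃ G : ℤ → ℝ, LatticeData (L / (2 * N)) K (2 * K / η) M N G ∧
      ∀ i : ℤ, 0 ≤ i → i ≤ N → P (i * (L / (2 * N))) - K * η ≤ G i ∧
        G i ≤ P (i * (L / (2 * N))) := by
  filter_upwards [eventually_ge_atTop 2, eventually_ge_atTop ⌈L / c⌉₊] with N hN hN'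
  have hNpos : (0 : ℝ) < N := by positivity
  have hc : 0 < c := by linarith
  set h := L / (2 * N) with hh
  have hpos : 0 < h := by positivity
  have hNh : N * h = L / 2 := by rw [hh]; field_simp
  have hhc : 2 * h ≤ c := by
    have := (Nat.ceil_le.1 hN')
    rw [div_le_iff₀ hc] at this
    rw [hh, ← mul_div_assoc, div_le_iff₀ (by positivity)]
    linarith
  set m := ⌊η / h⌋₊ with hm
  have hmη : m * h ≤ η := by
    rw [← le_div_iff₀ hpos]; exact Nat.floor_le (by positivity)
  have hmη' : η < (m + 1) * h := by
    rw [← div_lt_iff₀ hpos]; exact Nat.lt_floor_add_one _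
  set Q : ℤ → ℝ := fun i => P (i * h) with hQ
  have hQlip : ∀ i j, |Q i - Q j| ≤ K * h * |(i : ℝ) - j| := fun i j => by
    refine (hlip _ _).trans_eq ?_
    rw [← sub_mul, abs_mul, abs_of_pos hpos]; ring
  have hQconc : ∀ i j, Q (i + j) + Q (i - j) ≤ 2 * Q i := fun i j => by
    have := hconc (i * h) (j * h)
    simp only [hQ]
    push_cast
    rwa [add_mul, sub_mul]
  have hQ₁ : ∀ i : ℤ, i ≤ m + 1 → Q i = k₁ * (i * h) := fun i hi => h₁ _ <| by
    have : (i : ℝ) ≤ m + 1 := by exact_mod_cast hi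
    nlinarith
  have hQ₂ : ∀ i : ℤ, N - (m + 1) ≤ i → Q i = k₂ * (L / 2 - i * h) := fun i hi => h₂ _ <| by
    have : (N : ℝ) - (m + 1) ≤ i := by exact_mod_cast hi
    nlinarith
  have near₁ : ∀ i : ℤ, i ≤ 1 → windowAverage m Q i = k₁ * (i * h) := fun i hi =>
    windowAverage_eq_of_linear fun j hj => by
      have := abs_le.1 hj
      rw [hQ₁ _ (by omega), hQ₁ _ (by omega)]
      push_cast; ring
  have near₂ : ∀ i : ℤ, N - 1 ≤ i → windowAverage m Q i = k₂ * (L / 2 - i * h) := fun i hi =>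
    windowAverage_eq_of_linear fun j hj => by
      have := abs_le.1 hj
      rw [hQ₂ _ (by omega), hQ₂ _ (by omega)]
      push_cast; ring
  have e₁ : windowAverage m Q (-1) = -windowAverage m Q 1 := by
    rw [near₁ _ (by omega), near₁ _ (by omega)]; push_cast; ring
  have e₂ : windowAverage m Q (N + 1) = -windowAverage m Q (N - 1) := by
    rw [near₂ _ (by omega), near₂ _ (by omega), ← hNh]; push_cast; ring
  have bd : ∀ i : ℤ, 0 ≤ i → i ≤ N → (i : ℝ) * h ∈ Icc 0 (L / 2) := fun i hi hiN => by
    have a1 : (0 : ℝ) ≤ i := by exact_mod_cast hi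
    have a2 : (i : ℝ) ≤ N := by exact_mod_cast hiN
    exact ⟨by positivity, by rw [← hNh]; gcongr⟩
  refine ⟨oddExtension N (windowAverage m Q), latticeData_oddExtension hN
    (by rw [near₁ _ (by omega)]; simp) (by rw [near₂ _ (by omega), ← hNh]; simp) e₁ e₂
    (abs_windowAverage_sub_le hQlip) (fun i => (abs_windowAverage_second_diff_le hQlip i).trans ?_)
    (windowAverage_second_diff_nonpos hQconc)
    (fun i hi hiN => (windowAverage_le hQconc i).trans (hM _ (bd i hi hiN))), ?_⟩
  · rw [div_le_iff₀ (by positivity), show 2 * K / η * h ^ 2 * (2 * m + 1) =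
      2 * (K * h) * ((2 * m + 1) * h / η) by ring]
    refine le_mul_of_one_le_right (by positivity) ?_
    rw [le_div_iff₀ hη]
    have : (0 : ℝ) ≤ m * h := by positivity
    nlinarith
  · intro i hi hiN
    rw [oddExtension_eq hN e₁ e₂ (by omega) (by omega)]
    refine ⟨le_trans ?_ (le_windowAverage (by positivity) hQlip i), windowAverage_le hQconc i⟩
    have : K * (m * h) ≤ K * η := by gcongr
    simp only [hQ]
    linarith

section
variable {w : ℝ → ℝ} {L : ℝ} {ψ : ℝ → ℝ}

lemma sub_le_two_mul_of_odd_periodic_concave (hper : ∀ x, w (x + L) = w x)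
    (hodd : ∀ x, w (-x) = -w x) (hconc : ConcaveOn ℝ (Icc 0 (L / 2)) w)
    (hnn : ∀ x ∈ Icc 0 (L / 2), 0 ≤ w x) {d : ℝ} (hd : 0 < d) (hdL : d < L / 2) (m : ℝ) :
    w (m + d) - w (m - d) ≤ 2 * w d := by
  have hL : 0 < L := by linarith
  have w0 : w 0 = 0 := by have := hodd 0; rw [neg_zero] at this; linarith
  have hrefl : ∀ x, w (L - x) = -w x := fun x => by
    rw [← hodd, ← hper (-x)]; congr 1; ring
  have wH : w (L / 2) = 0 := by
    have := hrefl (L / 2)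
    rw [sub_half] at this; linarith
  have cc : ∀ p q a b : ℝ, p ∈ Icc 0 (L / 2) → q ∈ Icc 0 (L / 2) → 0 ≤ a → 0 ≤ b → 0 < a + b →
      a * w p + b * w q ≤ (a + b) * w ((a * p + b * q) / (a + b)) := by
    intro p q a b hp hq ha hb hab
    have := hconc.2 hp hq (div_nonneg ha hab.le) (div_nonneg hb hab.le)
      (by rw [← add_div, div_self hab.ne'])
    simp only [smul_eq_mul] at this
    rw [show a / (a + b) * p + b / (a + b) * q = (a * p + b * q) / (a + b) by ring,
      show a / (a + b) * w p + b / (a + b) * w q = (a * w p + b * w q) / (a + b) by ring,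
      div_le_iff₀ hab] at this
    linarith
  have lo : ∀ p q : ℝ, 0 ≤ p → p ≤ q → 0 < q → q ≤ L / 2 → p * w q ≤ q * w p := by
    intro p q hp hpq hq hqL
    have := cc q 0 p (q - p) ⟨hq.le, hqL⟩ ⟨le_rfl, by linarith⟩ hp (by linarith) (by linarith)
    rw [w0, add_sub_cancel, mul_zero, add_zero, add_zero, mul_div_cancel_right₀ _ hq.ne'] at this
    exact this
  have hi : ∀ p q : ℝ, 0 ≤ p → p ≤ q → p < L / 2 → q ≤ L / 2 →
      (L / 2 - q) * w p ≤ (L / 2 - p) * w q := by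
    intro p q hp hpq hpL hqL
    have := cc p (L / 2) (L / 2 - q) (q - p) ⟨hp, hpL.le⟩ ⟨by linarith, le_rfl⟩ (by linarith)
      (by linarith) (by linarith)
    rw [wH, sub_add_sub_cancel, mul_zero, add_zero,
      show (L / 2 - q) * p + (q - p) * (L / 2) = q * (L / 2 - p) by ring,
      mul_div_cancel_right₀ _ (by linarith)] at this
    exact this
  have key : ∀ m : ℝ, 0 ≤ m → m ≤ L / 2 → w (m + d) - w (m - d) ≤ 2 * w d := by
    intro m hm hmL
    have hwd := hnn d ⟨hd.le, hdL.le⟩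
    rcases le_total d m with h | h <;> rcases le_total (m + d) (L / 2) with h' | h'
    · have h1 := lo d (m + d) hd.le (by linarith) (by linarith) h'
      have h2 := lo (m - d) (m + d) (by linarith) (by linarith) (by linarith) h'
      refine le_of_mul_le_mul_left ?_ (by linarith : 0 < m + d)
      linarith
    · have h1 := hnn (L - (m + d)) ⟨by linarith, by linarith⟩
      rw [hrefl] at h1
      have h2 := hnn (m - d) ⟨by linarith, by linarith⟩
      linarith
    · have h1 := cc (m + d) (d - m) 1 1 ⟨by linarith, h'⟩ ⟨by linarith, by linarith⟩ zero_le_one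
        zero_le_one (by norm_num)
      rw [show (1 * (m + d) + 1 * (d - m)) / (1 + 1) = d by ring] at h1
      rw [← neg_sub d m, hodd]
      linarith
    · have h1 := hi (d - m) d (by linarith) (by linarith) (by linarith) hdL.le
      have h2 := hi (d - m) (L - (m + d)) (by linarith) (by linarith) (by linarith) (by linarith)
      rw [hrefl] at h2
      rw [← neg_sub d m, hodd]
      refine le_of_mul_le_mul_left ?_ (by linarith : 0 < L / 2 - (d - m))
      linarith
  have hpZ : ∀ (n : ℤ) x, w (x - n * L) = w x := fun n x => by
    have : Function.Periodic w L := hper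
    exact this.sub_int_mul_eq n
  have hround : |m - round (m / L) * L| ≤ L / 2 := by
    have := abs_sub_round (m / L)
    have e : m - round (m / L) * L = (m / L - round (m / L)) * L := by field_simp
    rw [e, abs_mul, abs_of_pos hL]
    nlinarith
  have h := key _ (abs_nonneg _) hround
  have e1 : w (m + d) = w (m - round (m / L) * L + d) := by
    rw [← hpZ (round (m / L))]; congr 1; ring
  have e2 : w (m - d) = w (m - round (m / L) * L - d) := by
    rw [← hpZ (round (m / L))]; congr 1; ring
  rw [e1, e2]
  generalize m - round (m / L) * L = k at h
  rcases abs_choice k with hk | hk <;> rw [hk] at h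
  · exact h
  · rw [show -k + d = -(k - d) by ring, show -k - d = -(k + d) by ring, hodd, hodd] at h
    linarith

lemma isModulus_of_odd_periodic_concave (hper : ∀ x, w (x + L) = w x)
    (hodd : ∀ x, w (-x) = -w x) (hconc : ConcaveOn ℝ (Icc 0 (L / 2)) w)
    (hnn : ∀ x ∈ Icc 0 (L / 2), 0 ≤ w x) (hle : ∀ x ∈ Ioo 0 (L / 2), w x ≤ ψ x) :
    IsModulus L ψ w := by
  have key : ∀ x y : ℝ, 0 < y - x → y - x < L → w y - w x ≤ 2 * ψ ((y - x) / 2) := by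
    intro x y h h'
    have h1 := sub_le_two_mul_of_odd_periodic_concave hper hodd hconc hnn (d := (y - x) / 2)
      (by linarith) (by linarith) ((x + y) / 2)
    have h2 := hle ((y - x) / 2) ⟨by linarith, by linarith⟩
    rw [show (x + y) / 2 + (y - x) / 2 = y by ring,
      show (x + y) / 2 - (y - x) / 2 = x by ring] at h1
    linarith
  intro x y h h'
  refine ⟨?_, key x y h h'⟩
  have := key y (x + L) (by linarith) (by linarith)
  rw [hper, show x + L - y = L + x - y by ring] at this
  linarith

end

section
variable {α A a : ℝ → ℝ} {K M L δ : ℝ} {P : ℝ → ℝ} {u v f : ℝ → ℝ → ℝ}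

lemma ParabolicSol.hasDerivAt_x_rescale (hu : ParabolicSol A a K M L δ P u v f) {κ : ℝ}
    (hκ : κ ≠ 0) (q s e x : ℝ) :
    HasDerivAt (fun y => κ * u ((y + q) / κ) s + e) (v ((x + q) / κ) s) x := by
  have h1 : HasDerivAt (fun y => (y + q) / κ) (1 / κ) x :=
    ((hasDerivAt_id x).add_const q).div_const κ
  have h2 := (((hu.hasDerivAt_x ((x + q) / κ) s).comp x h1).const_mul κ).add_const e
  refine h2.congr_deriv ?_
  field_simp

/-- Parabolic rescalings of a solution are regular and solve the equation. -/
lemma ParabolicSol.regularOn_rescale (hu : ParabolicSol A a K M L δ P u v f) (hα : Continuous α)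
    (hαpos : ∀ p, 0 < α p) (haα : ∀ p, |p| ≤ K → a p = α p) {κ : ℝ} (hκ : 0 < κ) (q τ e : ℝ)
    {S : Set (ℝ × ℝ)} (hS : ∀ p ∈ S, 0 < p.2 / κ ^ 2 + τ) :
    RegularOn (fun x t => κ * u ((x + q) / κ) (t / κ ^ 2 + τ) + e) S ∧
      ∀ p ∈ S, pderivT (fun x t => κ * u ((x + q) / κ) (t / κ ^ 2 + τ) + e) p.1 p.2 =
        α (pderivX (fun x t => κ * u ((x + q) / κ) (t / κ ^ 2 + τ) + e) p.1 p.2) *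
          pderivXX (fun x t => κ * u ((x + q) / κ) (t / κ ^ 2 + τ) + e) p.1 p.2 := by
  set w : ℝ → ℝ → ℝ := fun x t => κ * u ((x + q) / κ) (t / κ ^ 2 + τ) + e with hw
  have dx : ∀ x t, HasDerivAt (fun y => w y t) (v ((x + q) / κ) (t / κ ^ 2 + τ)) x := fun x t =>
    hu.hasDerivAt_x_rescale hκ.ne' q _ e x
  have pX : pderivX w = fun x t => v ((x + q) / κ) (t / κ ^ 2 + τ) := by
    ext x t; exact (dx x t).deriv
  have dxx : ∀ p ∈ S, HasDerivAt (fun y => pderivX w y p.2)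
      (f ((p.1 + q) / κ) (p.2 / κ ^ 2 + τ) /
        α (v ((p.1 + q) / κ) (p.2 / κ ^ 2 + τ)) / κ) p.1 := fun p hp => by
    rw [pX]
    have h1 : HasDerivAt (fun y => (y + q) / κ) (1 / κ) p.1 :=
      ((hasDerivAt_id p.1).add_const q).div_const κ
    have h2 := (hu.hasDerivAt_xx ((p.1 + q) / κ) _ (hS p hp)).comp p.1 h1
    refine h2.congr_deriv ?_
    rw [haα _ (hu.abs_v_le _ _)]; ring
  have dt : ∀ p ∈ S, HasDerivAt (fun s => w p.1 s)
      (f ((p.1 + q) / κ) (p.2 / κ ^ 2 + τ) / κ) p.2 := fun p hp => by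
    have h1 : HasDerivAt (fun s => s / κ ^ 2 + τ) (1 / κ ^ 2) p.2 :=
      ((hasDerivAt_id p.2).div_const _).add_const τ
    have h2 := (((hu.hasDerivAt_t ((p.1 + q) / κ) _ (hS p hp)).comp p.2 h1).const_mul κ).add_const e
    refine h2.congr_deriv ?_
    field_simp
  have pXX : ∀ p ∈ S, pderivXX w p.1 p.2 = f ((p.1 + q) / κ) (p.2 / κ ^ 2 + τ) /
      α (v ((p.1 + q) / κ) (p.2 / κ ^ 2 + τ)) / κ := fun p hp => (dxx p hp).deriv
  have pT : ∀ p ∈ S, pderivT w p.1 p.2 = f ((p.1 + q) / κ) (p.2 / κ ^ 2 + τ) / κ := fun p hp =>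
    (dt p hp).deriv
  have cΦ : Continuous fun p : ℝ × ℝ => ((p.1 + q) / κ, p.2 / κ ^ 2 + τ) := by fun_prop
  have cu := hu.continuous_u.comp cΦ
  have cv := hu.continuous_v.comp cΦ
  have cf : ContinuousOn (fun p : ℝ × ℝ => f ((p.1 + q) / κ) (p.2 / κ ^ 2 + τ)) S :=
    hu.continuousOn_f.comp cΦ.continuousOn fun p hp => ⟨mem_univ _, hS p hp⟩
  refine ⟨⟨((continuous_const.mul cu).add continuous_const).continuousOn,
    fun p _ => (dx p.1 p.2).differentiableAt, fun p hp => (dxx p hp).differentiableAt,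
    fun p hp => (dt p hp).differentiableAt, ?_, ?_, ?_⟩, ?_⟩
  · rw [pX]; exact cv.continuousOn
  · refine ContinuousOn.congr ?_ pXX
    exact (cf.div (hα.comp cv).continuousOn fun p _ => (hαpos _).ne').div_const κ
  · exact (cf.div_const κ).congr pT
  · intro p hp
    rw [pT p hp, pXX p hp, pX, mul_div_assoc', mul_div_cancel₀ _ (hαpos _).ne']

lemma ParabolicSol.concaveOn (hu : ParabolicSol A a K M L δ P u v f) (t : ℝ) :
    ConcaveOn ℝ (Icc 0 (L / 2)) fun x => u x t := by
  have hd : ∀ x, HasDerivAt (fun y => u y t) (v x t) x := fun x => hu.hasDerivAt_x x t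
  refine AntitoneOn.concaveOn_of_deriv (convex_Icc _ _)
    (fun x _ => (hd x).continuousAt.continuousWithinAt)
    (fun x _ => (hd x).differentiableAt.differentiableWithinAt) ?_
  rw [show deriv (fun x => u x t) = fun x => v x t from funext fun x => (hd x).deriv]
  exact (hu.anti_v t).mono interior_subset

lemma ParabolicSol.isModulus (hu : ParabolicSol A a K M L δ P u v f) {ψ : ℝ → ℝ}
    (hP : ∀ x ∈ Ioo 0 (L / 2), P x ≤ ψ x) {t : ℝ} (ht : 0 ≤ t) : IsModulus L ψ fun x => u x t :=
  isModulus_of_odd_periodic_concave (fun x => hu.per x t) (fun x => hu.odd x t) (hu.concaveOn t)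
    (fun x hx => hu.nonneg x hx t) fun x hx => by
      have hx' := Ioo_subset_Icc_self hx
      exact ((hu.time_anti x hx' ht).trans (hu.init x hx').2).trans (hP x hx)

lemma ParabolicSol.abs_sub_le (hu : ParabolicSol A a K M L δ P u v f) {d : ℝ} (hd : 0 < d)
    {x y : ℝ} (hx : x ∈ Icc (2 * d) (L / 2 - 2 * d)) (hy : y ∈ Icc (2 * d) (L / 2 - 2 * d))
    (t : ℝ) : |u y t - u x t| ≤ M / d * |y - x| :=
  (convex_Icc (2 * d) (L / 2 - 2 * d)).norm_image_sub_le_of_norm_hasDerivWithin_le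
    (f := fun x => u x t) (f' := fun x => v x t)
    (fun x _ => (hu.hasDerivAt_x x t).hasDerivWithinAt)
    (fun x hx => hu.abs_v_le_interior x t d hd hx.1 hx.2) hx hy

end

section
variable {α : ℝ → ℝ} {L : ℝ} {ψ : ℝ → ℝ}

lemma ConcaveOn.le_two_mul_of_pos_Ioo {H : ℝ} (hψ : ConcaveOn ℝ (Ioo 0 H) ψ)
    (hpos : ∀ z ∈ Ioo 0 H, 0 < ψ z) {x : ℝ} (hx : x ∈ Ioo 0 H) : ψ x ≤ 2 * ψ (H / 2) := by
  obtain ⟨h0, hH⟩ := hx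
  have hmid := hpos (H / 2) ⟨by linarith, by linarith⟩
  rcases le_total x (H / 2) with h | h
  · have := hψ.comp_const_sub.mul_le_mul_of_pos_Ioo
      (fun z hz => hpos _ ⟨by linarith [hz.2], by linarith [hz.1]⟩) (x := H / 2) (y := H - x)
      (by linarith) (by linarith) (by linarith)
    rw [sub_sub_cancel, sub_half] at this
    nlinarith
  · have := hψ.mul_le_mul_of_pos_Ioo hpos (by linarith) h hH
    nlinarith

lemma exists_parabolicSol_of_concave (hα : Continuous α) (hαpos : ∀ p, 0 < α p) (hL : 0 < L)
    (hψ : ConcaveOn ℝ (Ioo 0 (L / 2)) ψ) (hpos : ∀ z ∈ Ioo 0 (L / 2), 0 < ψ z) {c δ : ℝ}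
    (hc : 0 < c) (hcL : c ≤ L / 4) (hδ : 0 < δ) :
    ∃ (P A a : ℝ → ℝ) (K : ℝ) (u v f : ℝ → ℝ → ℝ),
      ParabolicSol A a K (2 * ψ (L / 4)) L δ P u v f ∧ (∀ p, |p| ≤ K → a p = α p) ∧
      (∀ x ∈ Icc c (L / 2 - c), P x = ψ x) ∧ (∀ x ∈ Ioo 0 (L / 2), P x ≤ ψ x) ∧
      ∀ B C, (∀ q, |q| ≤ B → α q ≤ C) → ∀ p, |p| ≤ B → |A p| ≤ B * C := by
  obtain ⟨P, K, k₁, k₂, hK, hlip, hconc, hPψ, hPle, hP0, h₁, h₂⟩ :=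
    exists_concave_cap hψ hpos hc (by linarith)
  obtain ⟨A, a, lam, Lam, hlam, hlL, hA, ha, ha0, haα, hAC⟩ :=
    exists_truncated_primitive hα hαpos hK.le
  have hmid : 0 < ψ (L / 4) := hpos _ ⟨by linarith, by linarith⟩
  have hM : ∀ x ∈ Icc 0 (L / 2), P x ≤ 2 * ψ (L / 4) := by
    intro x hx
    rcases hx.1.eq_or_lt with rfl | h0
    · rw [h₁ 0 hc.le]; linarith
    rcases hx.2.eq_or_lt with rfl | h0'
    · rw [h₂ _ (by linarith)]; linarith
    have := hψ.le_two_mul_of_pos_Ioo hpos ⟨h0, h0'⟩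
    rw [show L / 2 / 2 = L / 4 by ring] at this
    exact (hPle x ⟨h0, h0'⟩).trans this
  have hPc : Continuous P :=
    (LipschitzWith.of_dist_le_mul (K := ⟨K, hK.le⟩) fun x y => hlip x y).continuous
  set η := min (c / 2) (δ / K) with hη
  have hη0 : 0 < η := lt_min (by linarith) (by positivity)
  have hηc : 2 * η ≤ c := by linarith [min_le_left (c / 2) (δ / K)]
  have hηδ : K * η ≤ δ := by
    rw [mul_comm, ← le_div_iff₀ hK]; exact min_le_right _ _
  obtain ⟨u, v, f, hu⟩ := exists_parabolicSol (δ := δ) hlam hlL hA ha ha0 hL hPc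
    ((eventually_exists_latticeData hL hK.le hη0 hηc hlip hconc hM h₁ h₂).mono
      fun N ⟨G, hG, hGP⟩ => ⟨G, hG, fun i hi hiN =>
        ⟨by linarith [(hGP i hi hiN).1], (hGP i hi hiN).2⟩⟩)
  exact ⟨P, A, a, K, u, v, f, hu, haα, hPψ, hPle, hAC⟩

/-- Rescaled solutions are supersolutions, hence bound the minimal supersolution. -/
lemma psiPlus_le_rescale {A a : ℝ → ℝ} {K M δ σ : ℝ} {P : ℝ → ℝ} {u v f : ℝ → ℝ → ℝ}
    (hα : Continuous α) (hαpos : ∀ p, 0 < α p) (hL : 0 < L)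
    (hψ : ConcaveOn ℝ (Ioo 0 (L / 2)) ψ) (hpos : ∀ z ∈ Ioo 0 (L / 2), 0 < ψ z)
    (hu : ParabolicSol A a K M L δ P u v f) (haα : ∀ p, |p| ≤ K → a p = α p) (hδ : 0 ≤ δ)
    (hσ : 0 < σ)
    (hP : ∀ x ∈ Icc (σ * (L / 4) / (1 + σ)) (L / 2 - σ * (L / 4) / (1 + σ)), P x = ψ x)
    {z t : ℝ} (hz : z ∈ Ioo 0 (L / 2)) (ht : 0 < t) :
    psiPlus α L ψ z t ≤
      (1 + σ) * u ((z + σ * (L / 4)) / (1 + σ)) (t / (1 + σ) ^ 2) + (1 + σ) * δ := by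
  have hκ : 0 < 1 + σ := by linarith
  have hmem : ∀ x ∈ Icc 0 (L / 2), (x + σ * (L / 4)) / (1 + σ) ∈
      Icc (σ * (L / 4) / (1 + σ)) (L / 2 - σ * (L / 4) / (1 + σ)) := fun x hx => by
    constructor
    · gcongr; linarith [hx.1]
    · rw [le_sub_iff_add_le, ← add_div, div_le_iff₀ hκ]
      linarith [hx.2]
  have hc : 0 < σ * (L / 4) / (1 + σ) := by positivity
  set φ : ℝ → ℝ → ℝ := fun x s =>
    (1 + σ) * u ((x + σ * (L / 4)) / (1 + σ)) (s / (1 + σ) ^ 2 + 0) + (1 + σ) * δ with hφ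
  obtain ⟨hreg, hpde⟩ := hu.regularOn_rescale hα hαpos haα hκ (σ * (L / 4)) 0 ((1 + σ) * δ)
    (S := Ioo 0 (L / 2) ×ˢ Ioi 0) fun p hp => by
      have : 0 < p.2 := hp.2
      positivity
  have hS : MemS α L ψ φ := by
    refine ⟨fun x s hx _ => ?_, ?_, hreg, fun x s hx hs => (hpde (x, s) ⟨hx, hs⟩).ge, ?_⟩
    · have h1 := hmem x hx
      have := hu.nonneg ((x + σ * (L / 4)) / (1 + σ)) ⟨hc.le.trans h1.1, by linarith [h1.2]⟩
        (s / (1 + σ) ^ 2 + 0)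
      simp only [hφ]
      positivity
    · have cΦ : Continuous fun p : ℝ × ℝ =>
        ((p.1 + σ * (L / 4)) / (1 + σ), p.2 / (1 + σ) ^ 2 + 0) := by fun_prop
      exact ((continuous_const.mul (hu.continuous_u.comp cΦ)).add continuous_const).continuousOn
    · intro x hx
      have h1 := hmem x (Ioo_subset_Icc_self hx)
      have h2 := (hu.init ((x + σ * (L / 4)) / (1 + σ))
        ⟨hc.le.trans h1.1, by linarith [h1.2]⟩).1
      rw [hP _ h1] at h2
      have h4 : L / 4 ∈ Ioo 0 (L / 2) := ⟨by linarith, by linarith⟩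
      have h3 := hψ.2 hx h4 (by positivity : 0 ≤ 1 / (1 + σ)) (by positivity : 0 ≤ σ / (1 + σ))
        (by field_simp)
      simp only [smul_eq_mul] at h3
      rw [show 1 / (1 + σ) * x + σ / (1 + σ) * (L / 4) = (x + σ * (L / 4)) / (1 + σ) by ring] at h3
      have h5 : 0 ≤ σ / (1 + σ) * ψ (L / 4) := mul_nonneg (by positivity) (hpos _ h4).le
      have h6 : ψ x / (1 + σ) ≤ u ((x + σ * (L / 4)) / (1 + σ)) 0 + δ := by
        rw [← one_div_mul_eq_div]; linarith
      rw [div_le_iff₀ hκ] at h6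
      simp only [hφ, zero_div, add_zero]
      linarith
  have hbdd : BddBelow {y : ℝ | ∃ φ : ℝ → ℝ → ℝ, MemS α L ψ φ ∧ φ z t = y} := by
    refine ⟨0, ?_⟩
    rintro y ⟨φ', hφ', rfl⟩
    exact hφ'.1 z t (Ioo_subset_Icc_self hz) ht.le
  refine (csInf_le hbdd ⟨φ, hS, rfl⟩).trans_eq ?_
  simp only [hφ, add_zero]

lemma psiPlus_sharp_aux (hα : Continuous α) (hαpos : ∀ p, 0 < α p) (hL : 0 < L)
    (hψ : ConcaveOn ℝ (Ioo 0 (L / 2)) ψ) (hpos : ∀ z ∈ Ioo 0 (L / 2), 0 < ψ z) {z t ρ : ℝ}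
    (hz : z ∈ Ioo 0 (L / 2)) (ht : 0 < t) (hρ : ρ < psiPlus α L ψ z t) :
    ∃ (P A a : ℝ → ℝ) (K M δ τ : ℝ) (u v f : ℝ → ℝ → ℝ), ParabolicSol A a K M L δ P u v f ∧
      (∀ p, |p| ≤ K → a p = α p) ∧ (∀ x ∈ Ioo 0 (L / 2), P x ≤ ψ x) ∧ 0 < τ ∧
      ρ < u z (t + τ) := by
  set M := 2 * ψ (L / 4) with hM
  have hM0 : 0 < M := mul_pos two_pos (hpos _ ⟨by linarith, by linarith⟩)
  set d := min z (L / 2 - z) / 4 with hd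
  have hd0 : 0 < d := div_pos (lt_min hz.1 (by linarith [hz.2])) (by norm_num)
  have hdz : 4 * d ≤ z := by rw [hd]; linarith [min_le_left z (L / 2 - z)]
  have hdz' : 4 * d ≤ L / 2 - z := by rw [hd]; linarith [min_le_right z (L / 2 - z)]
  obtain ⟨q, -, hq⟩ := (isCompact_Icc (a := -(M / d)) (b := M / d)).exists_isMaxOn
    ⟨0, by simpa using by positivity⟩ hα.continuousOn
  set C := M / d * α q with hC
  set ε := psiPlus α L ψ z t - ρ with hε
  have hε0 : 0 < ε := sub_pos.2 hρ
  obtain ⟨r, hrε, hr0, hrd⟩ : ∃ r, 2 * (M / d) * r < ε ∧ 0 < r ∧ r ≤ d / 2 := by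
    have c1 : ContinuousAt (fun r => 2 * (M / d) * r) 0 := by fun_prop
    have e1 : ∀ᶠ r in 𝓝[>] (0 : ℝ), 2 * (M / d) * r < ε :=
      nhdsWithin_le_nhds (c1.eventually_lt_const (by simpa using hε0))
    have e2 : ∀ᶠ r in 𝓝[>] (0 : ℝ), r ≤ d / 2 :=
      nhdsWithin_le_nhds (eventually_le_nhds (by positivity))
    obtain ⟨r, h1, h2, h3⟩ := (e1.and (e2.and self_mem_nhdsWithin)).exists
    exact ⟨r, h1, h3, h2⟩
  set E : ℝ → ℝ := fun σ => σ * M + M / d * (σ * (L / 4)) + 2 * (M / d) * r +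
    |t / (1 + σ) ^ 2 - (t + σ)| * (4 * C) / r + (1 + σ) * σ with hE
  obtain ⟨σ, hEσ, hσd, hσ1, hσ⟩ : ∃ σ, E σ < ε ∧ σ * (L / 4) ≤ 2 * d ∧ σ ≤ 1 ∧ 0 < σ := by
    have c1 : ContinuousAt E 0 := by
      have : ContinuousAt (fun σ : ℝ => t / (1 + σ) ^ 2) 0 :=
        ContinuousAt.div (by fun_prop) (by fun_prop) (by norm_num)
      fun_prop
    have c2 : ContinuousAt (fun σ => σ * (L / 4)) 0 := by fun_prop
    have e1 : ∀ᶠ σ in 𝓝[>] (0 : ℝ), E σ < ε :=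
      nhdsWithin_le_nhds (c1.eventually_lt_const (by simpa [hE] using hrε))
    have e2 : ∀ᶠ σ in 𝓝[>] (0 : ℝ), σ * (L / 4) < 2 * d :=
      nhdsWithin_le_nhds (c2.eventually_lt_const (by simpa using hd0))
    have e3 : ∀ᶠ σ in 𝓝[>] (0 : ℝ), σ ≤ 1 := nhdsWithin_le_nhds (eventually_le_nhds one_pos)
    obtain ⟨σ, h1, h2, h3, h4⟩ := (e1.and (e2.and (e3.and self_mem_nhdsWithin))).exists
    exact ⟨σ, h1, h2.le, h3, h4⟩
  have hκ : 0 < 1 + σ := by linarith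
  obtain ⟨P, A, a, K, u, v, f, hu, haα, hPψ, hPle, hAC⟩ :=
    exists_parabolicSol_of_concave hα hαpos hL hψ hpos (c := σ * (L / 4) / (1 + σ)) (δ := σ)
      (by positivity) (by rw [div_le_iff₀ hκ]; nlinarith) hσ
  refine ⟨P, A, a, K, M, σ, σ, u, v, f, hu, haα, hPle, hσ, ?_⟩
  have h1 := psiPlus_le_rescale hα hαpos hL hψ hpos hu haα hσ.le hσ hPψ hz ht
  set y := (z + σ * (L / 4)) / (1 + σ) with hy
  set s := t / (1 + σ) ^ 2 with hs
  have hyz : |y - z| ≤ σ * (L / 4) := by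
    have e : y - z = σ * (L / 4 - z) / (1 + σ) := by rw [hy]; field_simp; ring
    have h2 : |L / 4 - z| ≤ L / 4 := abs_le.2 ⟨by linarith [hz.2], by linarith [hz.1]⟩
    rw [e, abs_div, abs_mul, abs_of_pos hσ, abs_of_pos hκ]
    refine (div_le_self (by positivity) (by linarith)).trans ?_
    gcongr
  have hyz' := abs_le.1 (hyz.trans hσd)
  have hy_mem : y ∈ Icc (2 * d) (L / 2 - 2 * d) := ⟨by linarith, by linarith⟩
  have hz_mem : z ∈ Icc (2 * d) (L / 2 - 2 * d) := ⟨by linarith, by linarith⟩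
  have h2 := hu.le y ⟨by linarith [hy_mem.1], by linarith [hy_mem.2]⟩ s
  have h3 := (le_abs_self _).trans (hu.abs_sub_le hd0 hz_mem hy_mem s)
  have h4 : M / d * |y - z| ≤ M / d * (σ * (L / 4)) := by gcongr
  have h5 := hu.time_drop z s (t + σ) d r C hr0 hrd
    (hAC (M / d) (α q) fun p hp => hq (abs_le.1 hp)) hz_mem.1 hz_mem.2
  rw [abs_sub_comm] at h5
  have h6 : σ * u y s ≤ σ * M := by gcongr
  simp only [hE] at hEσ
  linarith

end

theorem psiPlus_sharp
    (α : ℝ → ℝ) (hα : Continuous α) (hαpos : ∀ p, 0 < α p)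
    (L : ℝ) (hL : 0 < L) (ψ : ℝ → ℝ)
    (hψc : ContinuousOn ψ (Ioo 0 (L/2)))
    (hψconc : ConcaveOn ℝ (Ioo 0 (L/2)) ψ)
    (hψpos : ∀ z ∈ Ioo (0:ℝ) (L/2), 0 < ψ z) :
    ∀ z t : ℝ, z ∈ Ioo (0:ℝ) (L/2) → 0 < t → ∀ ρ : ℝ, ρ < psiPlus α L ψ z t →
      ∃ u : ℝ → ℝ → ℝ,
        (∀ x s : ℝ, u (x + L) s = u x s) ∧
        RegularOn u (univ ×ˢ Ici 0) ∧
        (∀ x : ℝ, ∀ s ∈ Ici (0:ℝ),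
          pderivT u x s = α (pderivX u x s) * pderivXX u x s) ∧
        IsModulus L ψ (fun x => u x 0) ∧
        ∃ x : ℝ, 2 * ρ < |u (x + 2 * z) t - u x t| := by
  intro z t hz ht ρ hρ
  obtain ⟨P, A, a, K, M, δ, τ, u, v, f, hu, haα, hPle, hτ, hlt⟩ :=
    psiPlus_sharp_aux hα hαpos hL hψconc hψpos hz ht hρ
  obtain ⟨hreg, hpde⟩ := hu.regularOn_rescale hα hαpos haα one_pos 0 τ 0 (S := univ ×ˢ Ici 0)
    fun p hp => by
      have : 0 ≤ p.2 := hp.2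
      positivity
  simp only [one_mul, add_zero, div_one, one_pow] at hreg hpde
  refine ⟨fun x s => u x (s + τ), fun x s => hu.per x _, hreg,
    fun x s hs => hpde (x, s) ⟨mem_univ _, hs⟩, ?_, -z, ?_⟩
  · exact hu.isModulus hPle (by linarith)
  · dsimp only
    rw [show -z + 2 * z = z by ring, hu.odd]
    refine lt_of_lt_of_le ?_ (le_abs_self _)
    linarith
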